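/- Let g and ḡ be projectively equivalent metrics on U. Then for all t, s ∈ ℝ the operators K̂^{(t)} and K̂^{(s)} commute: for every smooth function f : U → ℝ one has K̂^{(t)}(K̂^{(s)} f) = K̂^{(s)}(K̂^{(t)} f) on U. -/

import Mathlib

open Matrix

noncomputable section

/-- Partial derivative in the `i`-th coordinate direction of a real-valued function on `ℝⁿ`. -/
def pd {n : ℕ} (i : Fin n) (f : (Fin n → ℝ) → ℝ) : (Fin n → ℝ) → ℝ :=
  fun x => fderiv ℝ f x (Pi.single i 1)

/-- Iterated partial derivatives along a list of coordinate directions. -/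
def iterPD {n : ℕ} : List (Fin n) → ((Fin n → ℝ) → ℝ) → ((Fin n → ℝ) → ℝ)
  | [], f => f
  | i :: l, f => pd i (iterPD l f)

/-- `g` is a (pseudo-Riemannian) metric on `U`: a smooth field of invertible symmetric
real `n×n` matrices. -/
structure IsMetricOn {n : ℕ} (U : Set (Fin n → ℝ))
    (g : (Fin n → ℝ) → Matrix (Fin n) (Fin n) ℝ) : Prop where
  smooth : ∀ i j : Fin n, ContDiffOn ℝ (⊤ : ℕ∞) (fun x => g x i j) U
  symm : ∀ x ∈ U, (g x).IsSymm
  nondeg : ∀ x ∈ U, IsUnit (g x).det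

/-- The Christoffel symbols `Γ^k_{ij}` of the metric `g`. -/
def Gamma {n : ℕ} (g : (Fin n → ℝ) → Matrix (Fin n) (Fin n) ℝ)
    (k i j : Fin n) (x : Fin n → ℝ) : ℝ :=
  (1/2) * ∑ ℓ, (g x)⁻¹ k ℓ *
    (pd i (fun y => g y ℓ j) x + pd j (fun y => g y ℓ i) x - pd ℓ (fun y => g y i j) x)

/-- An open interval of `ℝ` (possibly empty or unbounded): an open order-connected set. -/
def IsOpenInterval (I : Set ℝ) : Prop := IsOpen I ∧ I.OrdConnected

/-- `γ` is a `g`-geodesic defined on the open interval `I`, with values in `U`. -/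
structure IsGeodesicOn {n : ℕ} (U : Set (Fin n → ℝ))
    (g : (Fin n → ℝ) → Matrix (Fin n) (Fin n) ℝ)
    (γ : ℝ → (Fin n → ℝ)) (I : Set ℝ) : Prop where
  interval : IsOpenInterval I
  smooth : ∀ k : Fin n, ContDiffOn ℝ (⊤ : ℕ∞) (fun s => γ s k) I
  mem : ∀ t ∈ I, γ t ∈ U
  eqn : ∀ t ∈ I, ∀ k : Fin n,
    deriv (deriv fun s => γ s k) t
      + ∑ i, ∑ j, Gamma g k i j (γ t) * deriv (fun s => γ s i) t * deriv (fun s => γ s j) t = 0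

/-- `g` and `gbar` are projectively equivalent on `U`: every `g`-geodesic with nowhere
vanishing velocity becomes, after a smooth reparameterization (a diffeomorphism of open
intervals), a `gbar`-geodesic. -/
def ProjEquiv {n : ℕ} (U : Set (Fin n → ℝ))
    (g gbar : (Fin n → ℝ) → Matrix (Fin n) (Fin n) ℝ) : Prop :=
  ∀ (γ : ℝ → (Fin n → ℝ)) (I : Set ℝ), IsGeodesicOn U g γ I →
    (∀ t ∈ I, ∃ k, deriv (fun s => γ s k) t ≠ 0) →
    ∃ (φ : ℝ → ℝ) (J : Set ℝ), IsOpenInterval J ∧ ContDiffOn ℝ (⊤ : ℕ∞) φ J ∧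
      Set.InjOn φ J ∧ φ '' J = I ∧ (∀ t ∈ J, deriv φ t ≠ 0) ∧
      IsGeodesicOn U gbar (γ ∘ φ) J

/-- The (1,1)-tensor `L = |det gbar / det g|^{1/(n+1)} gbar⁻¹ g` built from `g` and `gbar`. -/
def Lfield {n : ℕ} (g gbar : (Fin n → ℝ) → Matrix (Fin n) (Fin n) ℝ)
    (x : Fin n → ℝ) : Matrix (Fin n) (Fin n) ℝ :=
  |(gbar x).det / (g x).det| ^ ((1 : ℝ)/((n : ℝ)+1)) • ((gbar x)⁻¹ * g x)

/-- The family `S(t) = adjugate (t·Id − L)`. -/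
def Sfield {n : ℕ} (g gbar : (Fin n → ℝ) → Matrix (Fin n) (Fin n) ℝ) (t : ℝ)
    (x : Fin n → ℝ) : Matrix (Fin n) (Fin n) ℝ :=
  (t • (1 : Matrix (Fin n) (Fin n) ℝ) - Lfield g gbar x).adjugate

/-- The second order operator associated (via Carter's quantization) to a field `A` of
symmetric matrices: `Â f = |det g|^{-1/2} ∑ᵢⱼ ∂ᵢ(|det g|^{1/2} Aⁱʲ ∂ⱼ f)`. -/
def assocOp {n : ℕ} (g A : (Fin n → ℝ) → Matrix (Fin n) (Fin n) ℝ)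
    (f : (Fin n → ℝ) → ℝ) (x : Fin n → ℝ) : ℝ :=
  |(g x).det| ^ (-(1 : ℝ)/2) * ∑ i, ∑ j,
    pd i (fun y => |(g y).det| ^ ((1 : ℝ)/2) * A y i j * pd j f y) x

/-- The operator `K̂^{(t)}`, associated to `A = S(t)·g⁻¹`. -/
def Khat {n : ℕ} (g gbar : (Fin n → ℝ) → Matrix (Fin n) (Fin n) ℝ) (t : ℝ)
    (f : (Fin n → ℝ) → ℝ) (x : Fin n → ℝ) : ℝ :=
  assocOp g (fun y => Sfield g gbar t y * (g y)⁻¹) f x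

/-- The Beltrami-Laplace operator of `g`, associated to `A = g⁻¹`. -/
def LaplaceOp {n : ℕ} (g : (Fin n → ℝ) → Matrix (Fin n) (Fin n) ℝ)
    (f : (Fin n → ℝ) → ℝ) (x : Fin n → ℝ) : ℝ :=
  assocOp g (fun y => (g y)⁻¹) f x

/-- `K` is a Killing tensor for `g` on `U`: the associated quadratic function is constant
along every `g`-geodesic. -/
def IsKillingTensorOn {n : ℕ} (U : Set (Fin n → ℝ))
    (g K : (Fin n → ℝ) → Matrix (Fin n) (Fin n) ℝ) : Prop :=
  ∀ (γ : ℝ → (Fin n → ℝ)) (I : Set ℝ), IsGeodesicOn U g γ I →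
    ∀ τ₁ ∈ I, ∀ τ₂ ∈ I,
      (∑ i, ∑ j, deriv (fun s => γ s i) τ₁ * K (γ τ₁) i j * deriv (fun s => γ s j) τ₁) =
      (∑ i, ∑ j, deriv (fun s => γ s i) τ₂ * K (γ τ₂) i j * deriv (fun s => γ s j) τ₂)

/-- The covariant derivative `∇_k T_{ij}` of a (0,2)-tensor field `T`. -/
def covDeriv2 {n : ℕ} (g T : (Fin n → ℝ) → Matrix (Fin n) (Fin n) ℝ)
    (k i j : Fin n) (x : Fin n → ℝ) : ℝ :=
  pd k (fun y => T y i j) x - (∑ s, Gamma g s k i x * T x s j)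
    - ∑ s, Gamma g s k j x * T x i s

/-- The Ricci curvature tensor `R_{ij}` of `g`. -/
def Ricci {n : ℕ} (g : (Fin n → ℝ) → Matrix (Fin n) (Fin n) ℝ)
    (i j : Fin n) (x : Fin n → ℝ) : ℝ :=
  (∑ ℓ, pd ℓ (fun y => Gamma g ℓ i j y) x) - (∑ ℓ, pd i (fun y => Gamma g ℓ ℓ j y) x)
    + ∑ ℓ, ∑ s, (Gamma g ℓ ℓ s x * Gamma g s i j x - Gamma g ℓ i s x * Gamma g s ℓ j x)

/-- A function vanishes up to order `k` at `p`: it and all its partial derivatives of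
order `≤ k` vanish at `p`. -/
def VanishUpTo {n : ℕ} (k : ℕ) (f : (Fin n → ℝ) → ℝ) (p : Fin n → ℝ) : Prop :=
  ∀ l : List (Fin n), l.length ≤ k → iterPD l f p = 0


/-- The plain (flat) second order operator `Â f = ∑ᵢⱼ ∂ᵢ(Aⁱʲ ∂ⱼ f)` associated to a
matrix field `A`. -/
def opPlain {n : ℕ} (A : (Fin n → ℝ) → Matrix (Fin n) (Fin n) ℝ)
    (f : (Fin n → ℝ) → ℝ) (x : Fin n → ℝ) : ℝ :=
  ∑ i, ∑ j, pd i (fun y => A y i j * pd j f y) x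

end

namespace ProjComm

section DerivationMatrix

variable {𝒜 : Type*} [CommRing 𝒜] [Algebra ℝ 𝒜]

theorem eq_zero_of_two_mul {a : 𝒜} (h : 2 * a = 0) : a = 0 := by
  have : (2⁻¹ : ℝ) • (2 * a) = a := by
    rw [show (2 : 𝒜) * a = (2 : ℝ) • a by rw [two_smul, two_mul], smul_smul]; norm_num
  rw [← this, h, smul_zero]

theorem eq_of_two_mul {a b : 𝒜} (h : 2 * a = 2 * b) : a = b :=
  sub_eq_zero.1 (eq_zero_of_two_mul (by rw [mul_sub, h, sub_self]))

variable (δ : Derivation ℝ 𝒜 𝒜)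

theorem leibniz_mul (a b : 𝒜) : δ (a * b) = δ a * b + a * δ b := by
  rw [δ.leibniz, smul_eq_mul, smul_eq_mul]; ring

variable {l m n : Type*} [Fintype m]

theorem map_matrix_mul (M : Matrix l m 𝒜) (N : Matrix m n 𝒜) :
    (M * N).map δ = M.map δ * N + M * N.map δ := by
  ext i j
  simp only [map_apply, Matrix.mul_apply, Matrix.add_apply, map_sum, leibniz_mul,
    Finset.sum_add_distrib]

theorem map_mulVec (M : Matrix l m 𝒜) (v : m → 𝒜) :
    (fun k => δ ((M *ᵥ v) k)) = M.map δ *ᵥ v + M *ᵥ (fun k => δ (v k)) := by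
  ext i
  simp only [map_apply, mulVec, dotProduct, Pi.add_apply, map_sum, leibniz_mul,
    Finset.sum_add_distrib]

theorem map_dotProduct (v w : m → 𝒜) :
    δ (v ⬝ᵥ w) = (fun k => δ (v k)) ⬝ᵥ w + v ⬝ᵥ (fun k => δ (w k)) := by
  simp only [dotProduct, map_sum, leibniz_mul, Finset.sum_add_distrib]

theorem leibniz_prod {κ : Type*} [DecidableEq κ] (s : Finset κ) (a : κ → 𝒜) :
    δ (∏ i ∈ s, a i) = ∑ i ∈ s, (∏ j ∈ s.erase i, a j) * δ (a i) := by
  induction s using Finset.induction_on with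
  | empty => simp
  | insert i s hi ih =>
    rw [Finset.prod_insert hi, leibniz_mul, ih, Finset.sum_insert hi, Finset.erase_insert hi,
      Finset.mul_sum]
    congr 1
    · ring
    · refine Finset.sum_congr rfl fun j hj => ?_
      have hij : i ≠ j := fun h => hi (h ▸ hj)
      rw [Finset.erase_insert_of_ne hij, Finset.prod_insert (by simp [hi])]
      ring

/-- Jacobi's formula. -/
theorem leibniz_det [DecidableEq m] (M : Matrix m m 𝒜) :
    δ M.det = (M.adjugate * M.map δ).trace := by
  have h1 : ∀ i, (M.adjugate * M.map δ) i i = (M.updateCol i (fun k => δ (M k i))).det := by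
    intro i
    rw [← cramer_apply, cramer_eq_adjugate_mulVec]
    rfl
  simp only [trace, diag_apply, h1]
  simp only [det_apply, map_sum, Units.smul_def]
  rw [Finset.sum_comm]
  refine Finset.sum_congr rfl fun σ _ => ?_
  rw [map_zsmul, leibniz_prod, Finset.smul_sum]
  refine Finset.sum_congr rfl fun i _ => ?_
  congr 1
  rw [← Finset.mul_prod_erase _ _ (Finset.mem_univ i), mul_comm]
  congr 1
  · simp
  · refine Finset.prod_congr rfl fun j hj => ?_
    simp [Finset.ne_of_mem_erase hj]

theorem leibniz_det_of_inv [DecidableEq m] {M N : Matrix m m 𝒜} (h : N * M = 1) :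
    δ M.det = M.det * (N * M.map δ).trace := by
  have : M.adjugate = M.det • N := by
    calc M.adjugate = (N * M) * M.adjugate := by rw [h, Matrix.one_mul]
      _ = _ := by rw [Matrix.mul_assoc, mul_adjugate, Matrix.mul_smul, Matrix.mul_one]
  rw [leibniz_det, this, Matrix.smul_mul, trace_smul, smul_eq_mul]

theorem map_inv [DecidableEq m] {M N : Matrix m m 𝒜} (h : N * M = 1) :
    N.map δ = -(N * M.map δ * N) := by
  have h' : M * N = 1 := mul_eq_one_comm.1 h
  have h2 : (N * M).map δ = 0 := by
    rw [h]; ext i j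
    by_cases hij : i = j <;> simp [hij]
  rw [map_matrix_mul] at h2
  calc N.map δ = N.map δ * (M * N) := by rw [h', Matrix.mul_one]
    _ = (N.map δ * M + N * M.map δ) * N - N * M.map δ * N := by
      rw [Matrix.add_mul, Matrix.mul_assoc]; abel
    _ = _ := by rw [h2]; simp

end DerivationMatrix

/-- A pseudo-Riemannian metric `g`, its inverse `G` and its Levi-Civita connection `Γ`, over a
commutative `ℝ`-algebra with commuting derivations; `Γ i k j` is the Christoffel symbol with
upper index `k` and lower indices `i`, `j`. -/
structure MetricData (ι 𝒜 : Type*) [Fintype ι] [DecidableEq ι] [CommRing 𝒜] [Algebra ℝ 𝒜] where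
  /-- the coordinate derivations -/
  D : ι → Derivation ℝ 𝒜 𝒜
  D_comm : ∀ i j a, D i (D j a) = D j (D i a)
  /-- the metric -/
  g : Matrix ι ι 𝒜
  /-- the inverse metric -/
  G : Matrix ι ι 𝒜
  /-- the connection matrices -/
  Γ : ι → Matrix ι ι 𝒜
  g_symm : gᵀ = g
  g_mul_G : g * G = 1
  torsion : ∀ i j k, Γ i k j = Γ j k i
  compat : ∀ i, g.map (D i) = g * Γ i + (Γ i)ᵀ * g

namespace MetricData

variable {ι 𝒜 : Type*} [Fintype ι] [DecidableEq ι] [CommRing 𝒜] [Algebra ℝ 𝒜]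
variable (m : MetricData ι 𝒜)

/-- Covariant derivative of a vector field. -/
def covVec (i : ι) (v : ι → 𝒜) : ι → 𝒜 := (fun k => m.D i (v k)) + m.Γ i *ᵥ v

/-- Covariant derivative of an endomorphism field. -/
def covMat (i : ι) (M : Matrix ι ι 𝒜) : Matrix ι ι 𝒜 := M.map (m.D i) + m.Γ i * M - M * m.Γ i

/-- The endomorphism `X ↦ ∇_X v`. -/
def cd (v : ι → 𝒜) : Matrix ι ι 𝒜 := of fun k i => m.covVec i v k

/-- Divergence of a vector field. -/
def dv (v : ι → 𝒜) : 𝒜 := (m.cd v).trace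

/-- Curvature endomorphisms. -/
def curv (i j : ι) : Matrix ι ι 𝒜 :=
  (m.Γ j).map (m.D i) - (m.Γ i).map (m.D j) + m.Γ i * m.Γ j - m.Γ j * m.Γ i

/-- Ricci tensor. -/
def ric : Matrix ι ι 𝒜 := of fun i j => ∑ k, m.curv k i k j

/-- The scalar product defined by the metric. -/
def bil (x y : ι → 𝒜) : 𝒜 := x ⬝ᵥ m.g *ᵥ y

/-- The endomorphism `x ↦ ⟨b, x⟩ a`. -/
def rk (a b : ι → 𝒜) : Matrix ι ι 𝒜 := vecMulVec a (m.g *ᵥ b)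

/-- The differential of a function. -/
def df (a : 𝒜) : ι → 𝒜 := fun i => m.D i a

/-- Self-adjointness with respect to the metric. -/
def SA (M : Matrix ι ι 𝒜) : Prop := m.g * M = Mᵀ * m.g

theorem G_mul_g : m.G * m.g = 1 := mul_eq_one_comm.1 m.g_mul_G

theorem G_symm : m.Gᵀ = m.G := by
  calc m.Gᵀ = m.Gᵀ * (m.g * m.G) := by rw [m.g_mul_G, Matrix.mul_one]
    _ = (m.g * m.G)ᵀ * m.G := by rw [transpose_mul, m.g_symm, Matrix.mul_assoc]
    _ = m.G := by rw [m.g_mul_G, transpose_one, Matrix.one_mul]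

theorem bil_comm (x y : ι → 𝒜) : m.bil x y = m.bil y x := by
  rw [bil, dotProduct_comm, dotProduct_comm, dotProduct_mulVec, ← mulVec_transpose, m.g_symm,
    dotProduct_comm, bil]

theorem bil_mulVec {M : Matrix ι ι 𝒜} (h : m.SA M) (x y : ι → 𝒜) :
    m.bil (M *ᵥ x) y = m.bil x (M *ᵥ y) := by
  rw [bil, bil, mulVec_mulVec, h, ← mulVec_mulVec, dotProduct_mulVec x, ← mulVec_transpose,
    transpose_transpose]

theorem bil_add_right (x y z : ι → 𝒜) : m.bil x (y + z) = m.bil x y + m.bil x z := by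
  simp [bil, mulVec_add]

theorem bil_add_left (x y z : ι → 𝒜) : m.bil (x + y) z = m.bil x z + m.bil y z := by
  simp [bil]

theorem bil_smul_right (c : 𝒜) (x y : ι → 𝒜) : m.bil x (c • y) = c * m.bil x y := by
  simp [bil, mulVec_smul]

theorem bil_smul_left (c : 𝒜) (x y : ι → 𝒜) : m.bil (c • x) y = c * m.bil x y := by
  simp [bil]

theorem rk_mulVec (a b x : ι → 𝒜) : m.rk a b *ᵥ x = m.bil b x • a := by
  rw [m.bil_comm]
  ext i
  simp only [rk, vecMulVec, bil, mulVec, dotProduct, of_apply, Pi.smul_apply, smul_eq_mul,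
    Finset.sum_mul]
  exact Finset.sum_congr rfl fun j _ => by ring

theorem trace_rk (a b : ι → 𝒜) : (m.rk a b).trace = m.bil a b := by
  simp [rk, bil, trace_vecMulVec]

theorem mul_rk (M : Matrix ι ι 𝒜) (a b : ι → 𝒜) : M * m.rk a b = m.rk (M *ᵥ a) b := by
  rw [rk, mul_vecMulVec, rk]

theorem rk_mul {M : Matrix ι ι 𝒜} (h : m.SA M) (a b : ι → 𝒜) :
    m.rk a b * M = m.rk a (M *ᵥ b) := by
  rw [rk, vecMulVec_mul, rk, mulVec_mulVec, h, ← mulVec_mulVec, mulVec_transpose]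

theorem SA.inv {m : MetricData ι 𝒜} {M N : Matrix ι ι 𝒜} (h : m.SA M) (hN : N * M = 1) :
    m.SA N := by
  have hN' : M * N = 1 := mul_eq_one_comm.1 hN
  calc m.g * N = (M * N)ᵀ * (m.g * N) := by rw [hN', transpose_one, Matrix.one_mul]
    _ = Nᵀ * (Mᵀ * m.g) * N := by rw [transpose_mul]; simp only [Matrix.mul_assoc]
    _ = Nᵀ * m.g * (M * N) := by rw [← h]; simp only [Matrix.mul_assoc]
    _ = _ := by rw [hN', Matrix.mul_one]

theorem SA.mul {m : MetricData ι 𝒜} {M N : Matrix ι ι 𝒜} (hM : m.SA M) (hN : m.SA N)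
    (hc : M * N = N * M) : m.SA (M * N) := by
  rw [SA, ← Matrix.mul_assoc, hM, Matrix.mul_assoc, hN, ← Matrix.mul_assoc, ← transpose_mul, hc]

theorem covVec_mulVec (i : ι) (M : Matrix ι ι 𝒜) (v : ι → 𝒜) :
    m.covVec i (M *ᵥ v) = m.covMat i M *ᵥ v + M *ᵥ m.covVec i v := by
  rw [covVec, map_mulVec, covMat, covVec]
  simp only [mulVec_add, sub_mulVec, add_mulVec, mulVec_mulVec]
  abel

theorem covMat_mul (i : ι) (M N : Matrix ι ι 𝒜) :
    m.covMat i (M * N) = m.covMat i M * N + M * m.covMat i N := by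
  simp only [covMat, map_matrix_mul, Matrix.add_mul, Matrix.mul_add, Matrix.sub_mul,
    Matrix.mul_sub, Matrix.mul_assoc]
  abel

theorem covVec_smul (i : ι) (a : 𝒜) (v : ι → 𝒜) :
    m.covVec i (a • v) = m.D i a • v + a • m.covVec i v := by
  ext k
  simp [covVec, mulVec_smul]; ring

theorem covVec_add (i : ι) (v w : ι → 𝒜) :
    m.covVec i (v + w) = m.covVec i v + m.covVec i w := by
  ext k
  simp [covVec, mulVec_add]; ring

theorem covVec_sum {κ : Type*} (i : ι) (s : Finset κ) (v : κ → ι → 𝒜) :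
    m.covVec i (∑ a ∈ s, v a) = ∑ a ∈ s, m.covVec i (v a) := by
  classical
  induction s using Finset.induction_on with
  | empty => ext; simp [covVec]
  | insert a s ha ih => rw [Finset.sum_insert ha, Finset.sum_insert ha, covVec_add, ih]

theorem covVec_comm (i j : ι) (v : ι → 𝒜) :
    m.covVec i (m.covVec j v) - m.covVec j (m.covVec i v) = m.curv i j *ᵥ v := by
  ext k
  have e : ∀ i j, m.covVec i (m.covVec j v) k = m.D i (m.D j (v k)) +
      (((m.Γ j).map (m.D i)) *ᵥ v) k + (m.Γ j *ᵥ fun k => m.D i (v k)) k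
      + (m.Γ i *ᵥ fun k => m.D j (v k)) k + ((m.Γ i * m.Γ j) *ᵥ v) k := by
    intro i j
    have := congrFun (map_mulVec (m.D i) (m.Γ j) v) k
    simp only [Pi.add_apply] at this
    simp only [covVec, Pi.add_apply, map_add, mulVec_add, mulVec_mulVec, this]
    ring
  rw [Pi.sub_apply, e, e, m.D_comm i j]
  simp only [curv, sub_mulVec, add_mulVec, Pi.sub_apply, Pi.add_apply]
  ring

theorem covMat_comm (i j : ι) (M : Matrix ι ι 𝒜) :
    m.covMat i (m.covMat j M) - m.covMat j (m.covMat i M) = m.curv i j * M - M * m.curv i j := by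
  have hadd : ∀ i (A B : Matrix ι ι 𝒜), (A + B).map (m.D i) = A.map (m.D i) + B.map (m.D i) :=
    fun i A B => by ext; simp
  have hsub : ∀ i (A B : Matrix ι ι 𝒜), (A - B).map (m.D i) = A.map (m.D i) - B.map (m.D i) :=
    fun i A B => by ext; simp
  have hc : (M.map (m.D j)).map (m.D i) = (M.map (m.D i)).map (m.D j) := by
    ext a b; simp [m.D_comm i j]
  simp only [covMat, curv, map_matrix_mul, hadd, hsub, Matrix.add_mul, Matrix.mul_add,
    Matrix.sub_mul, Matrix.mul_sub, Matrix.mul_assoc, hc]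
  abel

theorem dv_eq (v : ι → 𝒜) : m.dv v = ∑ k, m.covVec k v k := rfl

theorem dv_add (v w : ι → 𝒜) : m.dv (v + w) = m.dv v + m.dv w := by
  simp [dv_eq, covVec_add, Finset.sum_add_distrib]

theorem dv_smul (a : 𝒜) (v : ι → 𝒜) : m.dv (a • v) = m.df a ⬝ᵥ v + a * m.dv v := by
  simp [dv_eq, covVec_smul, Finset.sum_add_distrib, Finset.mul_sum, dotProduct, df]

theorem dv_neg (v : ι → 𝒜) : m.dv (-v) = -m.dv v := by
  have := m.dv_smul (-1) v
  have h : m.df (-1) = 0 := by ext; simp [df]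
  simpa [h] using this

theorem dv_sub (v w : ι → 𝒜) : m.dv (v - w) = m.dv v - m.dv w := by
  rw [sub_eq_add_neg, dv_add, dv_neg, sub_eq_add_neg]

/-- The contracted Ricci identity. -/
theorem dv_mul_dv (X Y : ι → 𝒜) :
    m.dv X * m.dv Y = m.dv (m.dv Y • X - m.cd Y *ᵥ X) + (m.cd X * m.cd Y).trace
      + X ⬝ᵥ m.ric *ᵥ Y := by
  have h1 : ∀ k, m.covVec k (m.cd Y *ᵥ X) k
      = ∑ i, m.D k (X i) * m.covVec i Y k + ∑ i, X i * m.covVec k (m.covVec i Y) k := by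
    intro k
    have : m.cd Y *ᵥ X = ∑ i, X i • m.covVec i Y := by
      ext j
      simp [cd, mulVec, dotProduct, mul_comm]
    rw [this, covVec_sum, ← Finset.sum_add_distrib, Finset.sum_apply]
    exact Finset.sum_congr rfl fun i _ => by rw [covVec_smul]; simp
  have h2 : m.df (m.dv Y) ⬝ᵥ X = ∑ k, ∑ i, X i * m.covVec i (m.covVec k Y) k
      - ∑ k, ∑ i, X i * (m.Γ i *ᵥ m.covVec k Y) k := by
    have h3 : ∀ i k, m.D i (m.covVec k Y k) =
        m.covVec i (m.covVec k Y) k - (m.Γ i *ᵥ m.covVec k Y) k := by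
      intro i k
      have : m.covVec i (m.covVec k Y) k
        = m.D i (m.covVec k Y k) + (m.Γ i *ᵥ m.covVec k Y) k := rfl
      rw [this, add_sub_cancel_right]
    simp only [df, dv_eq, dotProduct, map_sum, Finset.sum_mul, h3, sub_mul,
      Finset.sum_sub_distrib]
    rw [Finset.sum_comm, Finset.sum_comm (γ := ι)
      (f := fun k i => X i * (m.Γ i *ᵥ m.covVec k Y) k)]
    congr 1
    · exact Finset.sum_congr rfl fun _ _ => Finset.sum_congr rfl fun _ _ => mul_comm _ _
    · exact Finset.sum_congr rfl fun _ _ => Finset.sum_congr rfl fun _ _ => mul_comm _ _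
  have h4 : (m.cd X * m.cd Y).trace = ∑ k, ∑ i, m.D k (X i) * m.covVec i Y k
      + ∑ k, ∑ i, X i * (m.Γ i *ᵥ m.covVec k Y) k := by
    have e : ∑ k, ∑ i, X i * (m.Γ i *ᵥ m.covVec k Y) k
        = ∑ k, ∑ i, (m.Γ i *ᵥ X) k * m.covVec k Y i := by
      refine Finset.sum_congr rfl fun k _ => ?_
      simp only [mulVec, dotProduct, Finset.mul_sum, Finset.sum_mul]
      rw [Finset.sum_comm]
      refine Finset.sum_congr rfl fun i _ => Finset.sum_congr rfl fun j _ => ?_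
      rw [m.torsion]; ring
    rw [e, Finset.sum_comm (γ := ι) (f := fun k i => m.D k (X i) * m.covVec i Y k)]
    simp only [trace, diag_apply, Matrix.mul_apply, cd, of_apply, ← Finset.sum_add_distrib]
    exact Finset.sum_congr rfl fun k _ => Finset.sum_congr rfl fun i _ => by
      rw [covVec, Pi.add_apply, add_mul]
  have h5 : X ⬝ᵥ m.ric *ᵥ Y = ∑ k, ∑ i, X i * (m.covVec k (m.covVec i Y) k
      - m.covVec i (m.covVec k Y) k) := by
    simp only [← Pi.sub_apply, covVec_comm]
    simp only [dotProduct, mulVec, ric, of_apply, Finset.sum_mul, Finset.mul_sum]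
    rw [Finset.sum_comm (γ := ι) (f := fun k i => ∑ x, X i * (m.curv k i k x * Y x))]
    exact Finset.sum_congr rfl fun _ _ => Finset.sum_comm
  rw [dv_sub, dv_smul, h2, h4, h5, dv_eq m (m.cd Y *ᵥ X)]
  simp only [h1, Finset.sum_add_distrib, mul_sub, Finset.sum_sub_distrib]
  ring

end MetricData

namespace MetricData

variable {ι 𝒜 : Type*} [Fintype ι] [DecidableEq ι] [CommRing 𝒜] [Algebra ℝ 𝒜]
variable (m : MetricData ι 𝒜)

theorem df_flat (i : ι) (x : ι → 𝒜) (j : ι) :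
    m.D i ((m.g *ᵥ x) j) = (m.g *ᵥ m.covVec i x) j + ((m.Γ i)ᵀ *ᵥ m.g *ᵥ x) j := by
  have := congrFun (map_mulVec (m.D i) m.g x) j
  rw [this, m.compat, covVec]
  simp only [add_mulVec, mulVec_add, mulVec_mulVec, Pi.add_apply]
  ring

theorem D_bil (i : ι) (x y : ι → 𝒜) :
    m.D i (m.bil x y) = m.bil (m.covVec i x) y + m.bil x (m.covVec i y) := by
  rw [bil, map_dotProduct]
  have : (fun k => m.D i ((m.g *ᵥ y) k)) = m.g *ᵥ m.covVec i y + (m.Γ i)ᵀ *ᵥ m.g *ᵥ y :=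
    funext fun k => m.df_flat i y k
  rw [this, dotProduct_add, bil, bil, covVec.eq_def m i x, add_dotProduct,
    dotProduct_mulVec x (m.Γ i)ᵀ, vecMul_transpose]
  ring

/-- The covariant differential of a vector field dual to a closed form is self-adjoint. -/
theorem SA_cd {x : ι → 𝒜} (h : ∀ i j, m.D i ((m.g *ᵥ x) j) = m.D j ((m.g *ᵥ x) i)) :
    m.SA (m.cd x) := by
  have key : ∀ i j, (m.g *ᵥ m.covVec i x) j = (m.g *ᵥ m.covVec j x) i := by
    intro i j
    have h1 := m.df_flat i x j
    have h2 := m.df_flat j x i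
    have h3 : ((m.Γ i)ᵀ *ᵥ m.g *ᵥ x) j = ((m.Γ j)ᵀ *ᵥ m.g *ᵥ x) i := by
      exact Finset.sum_congr rfl fun k _ => congrArg (· * _) (m.torsion i j k)
    linear_combination h2 - h1 + h i j - h3
  have e : ∀ i j, (m.g * m.cd x) j i = (m.g *ᵥ m.covVec i x) j := fun i j => rfl
  rw [SA]
  ext i j
  calc (m.g * m.cd x) i j = (m.g * m.cd x) j i := by rw [e, e, key]
    _ = ((m.g * m.cd x)ᵀ) i j := rfl
    _ = _ := by rw [transpose_mul, m.g_symm]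

theorem covMat_rk (i : ι) (a b : ι → 𝒜) :
    m.covMat i (m.rk a b) = m.rk (m.covVec i a) b + m.rk a (m.covVec i b) := by
  have h := m.df_flat i b
  ext j k
  have h1 : (m.Γ i * m.rk a b) j k = (m.Γ i *ᵥ a) j * (m.g *ᵥ b) k := by
    rw [mul_rk, rk, vecMulVec_apply]
  have h2 : (m.rk a b * m.Γ i) j k = a j * ((m.Γ i)ᵀ *ᵥ m.g *ᵥ b) k := by
    rw [rk, vecMulVec_mul, vecMulVec_apply, mulVec_transpose]
  simp only [covMat, Matrix.sub_apply, Matrix.add_apply, h1, h2, map_apply]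
  simp only [rk, vecMulVec_apply, leibniz_mul, h, covVec, Pi.add_apply]
  ring

theorem covMat_smul (i : ι) (a : 𝒜) (M : Matrix ι ι 𝒜) :
    m.covMat i (a • M) = m.D i a • M + a • m.covMat i M := by
  have : (a • M).map (m.D i) = m.D i a • M + a • M.map (m.D i) := by
    ext j k
    simp only [map_apply, Matrix.smul_apply, Matrix.add_apply, smul_eq_mul, leibniz_mul]
  simp only [covMat, this, Matrix.mul_smul, Matrix.smul_mul, smul_sub, smul_add]
  abel

theorem covMat_one (i : ι) : m.covMat i 1 = 0 := by
  have : (1 : Matrix ι ι 𝒜).map (m.D i) = 0 := by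
    ext j k
    by_cases h : j = k <;> simp [h]
  simp [covMat, this]

theorem covMat_sub (i : ι) (M N : Matrix ι ι 𝒜) :
    m.covMat i (M - N) = m.covMat i M - m.covMat i N := by
  have : (M - N).map (m.D i) = M.map (m.D i) - N.map (m.D i) := by ext; simp
  simp only [covMat, this, Matrix.mul_sub, Matrix.sub_mul]
  abel

theorem trace_covMat (i : ι) (M : Matrix ι ι 𝒜) : (m.covMat i M).trace = m.D i M.trace := by
  rw [covMat, trace_sub, trace_add, trace_mul_comm (m.Γ i), add_sub_cancel_right]
  simp [trace]

/-- The curvature tensor with all indices down. -/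
def low (i j : ι) : Matrix ι ι 𝒜 := m.g * m.curv i j

theorem low_skew (i j a b : ι) : m.low i j b a = -m.low i j a b := by
  have hadd : ∀ i (A B : Matrix ι ι 𝒜), (A + B).map (m.D i) = A.map (m.D i) + B.map (m.D i) :=
    fun i A B => by ext; simp
  have ht : ∀ i (A : Matrix ι ι 𝒜), (Aᵀ).map (m.D i) = (A.map (m.D i))ᵀ := fun i A => rfl
  have hc : (m.g.map (m.D j)).map (m.D i) = (m.g.map (m.D i)).map (m.D j) := by
    ext a b; simp [m.D_comm i j]
  rw [m.compat, m.compat] at hc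
  simp only [hadd, map_matrix_mul, m.compat, ht] at hc
  have : (m.low i j)ᵀ = -m.low i j := by
    rw [low, transpose_mul, m.g_symm, curv, ← sub_eq_zero]
    rw [← sub_eq_zero] at hc
    rw [← hc]
    simp only [transpose_add, transpose_sub, transpose_mul, Matrix.mul_add, Matrix.add_mul,
      Matrix.mul_sub, Matrix.sub_mul, Matrix.mul_assoc]
    abel
  exact congrFun (congrFun this a) b

theorem low_swap (i j a b : ι) : m.low j i a b = -m.low i j a b := by
  have : m.curv j i = -m.curv i j := by simp only [curv]; abel
  rw [low, this, Matrix.mul_neg]; rfl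

theorem curv_bianchi (i j k l : ι) : m.curv i j k l + m.curv j l k i + m.curv l i k j = 0 := by
  simp only [curv, Matrix.add_apply, Matrix.sub_apply, map_apply, Matrix.mul_apply]
  have e : ∀ i j l, ∑ x, m.Γ i k x * m.Γ j x l = ∑ x, m.Γ i k x * m.Γ l x j := by
    intro i j l
    exact Finset.sum_congr rfl fun x _ => by rw [m.torsion j l]
  rw [m.torsion j l k, m.torsion i l k, m.torsion i j k, e j i l, e i j l, e l i j]
  ring

theorem low_bianchi (i j a l : ι) : m.low i j a l + m.low j l a i + m.low l i a j = 0 := by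
  simp only [low, Matrix.mul_apply, ← Finset.sum_add_distrib, ← mul_add, curv_bianchi, mul_zero,
    Finset.sum_const_zero]

theorem low_pair (i j a b : ι) : m.low i j a b = m.low a b i j := by
  apply eq_of_two_mul
  have s := m.low_skew
  have w := m.low_swap
  have B := m.low_bianchi
  linear_combination B i j a b - B i j b a - B a b i j + B a b j i
    + s i j a b + w a j b i + s a i j b + w j b i a - s j b a i + w a j i b - s a j b i
    - s a b i j - s b i a j - w a i j b

theorem low_contract {W : Matrix ι ι 𝒜} (hW : Wᵀ = W) (j b : ι) :
    ∑ i, (W * m.low i j) i b = ∑ i, (W * m.low i b) i j := by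
  simp only [Matrix.mul_apply]
  rw [Finset.sum_comm]
  refine Finset.sum_congr rfl fun i _ => Finset.sum_congr rfl fun c _ => ?_
  have : W c i = W i c := congrFun (congrFun hW i) c
  rw [this, m.low_pair c j i b]

theorem curv_eq (i j : ι) : m.curv i j = m.G * m.low i j := by
  rw [low, ← Matrix.mul_assoc, m.G_mul_g, Matrix.one_mul]

theorem ric_symm : m.ricᵀ = m.ric := by
  ext j b
  have : ∀ j b, m.ric j b = ∑ i, (m.G * m.low i j) i b := by
    intro j b; simp only [← curv_eq]; rfl
  rw [transpose_apply, this, this, m.low_contract m.G_symm]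

end MetricData

/-- A metric with a self-adjoint solution `L` of the equation
`∇ₖ Lᵢⱼ = λᵢ gⱼₖ + λⱼ gᵢₖ`. -/
structure BenentiData (ι 𝒜 : Type*) [Fintype ι] [DecidableEq ι] [CommRing 𝒜] [Algebra ℝ 𝒜]
    extends MetricData ι 𝒜 where
  /-- the solution -/
  L : Matrix ι ι 𝒜
  /-- half the gradient of the trace of `L` -/
  lam : ι → 𝒜
  SA_L : toMetricData.SA L
  covMat_L : ∀ i, toMetricData.covMat i L =
    toMetricData.rk lam (Pi.single i 1) + toMetricData.rk (Pi.single i 1) lam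

namespace BenentiData

variable {ι 𝒜 : Type*} [Fintype ι] [DecidableEq ι] [CommRing 𝒜] [Algebra ℝ 𝒜]
variable (m : BenentiData ι 𝒜)

theorem bil_single (i : ι) (x : ι → 𝒜) : m.bil x (Pi.single i 1) = (m.g *ᵥ x) i := by
  rw [m.bil_comm, MetricData.bil, single_one_dotProduct]

theorem D_trace_L (i : ι) : m.D i m.L.trace = 2 * (m.g *ᵥ m.lam) i := by
  rw [← m.trace_covMat, m.covMat_L, trace_add, m.trace_rk, m.trace_rk,
    m.bil_comm (Pi.single i 1), bil_single, two_mul]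

theorem SA_cd_lam : m.SA (m.cd m.lam) := by
  apply m.SA_cd
  intro i j
  apply eq_of_two_mul
  have h := m.D_comm i j m.L.trace
  have h2 : ∀ i a, m.D i (2 * a) = 2 * m.D i a := by
    intro i a; rw [two_mul, map_add, two_mul]
  rwa [D_trace_L, D_trace_L, h2, h2] at h

theorem covVec_single (i j : ι) :
    m.covVec i (Pi.single j 1) = m.covVec j (Pi.single i 1) := by
  ext k
  have : ∀ i j k : ι, m.D i ((Pi.single j 1 : ι → 𝒜) k) = 0 := by
    intro i j k
    by_cases h : k = j
    · subst h; simp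
    · simp [h]
  simp only [MetricData.covVec, Pi.add_apply, this, mulVec_single_one, col_apply]
  rw [m.torsion]

theorem curv_L (i j : ι) : m.curv i j * m.L - m.L * m.curv i j =
    m.rk (m.covVec i m.lam) (Pi.single j 1) + m.rk (Pi.single j 1) (m.covVec i m.lam)
    - (m.rk (m.covVec j m.lam) (Pi.single i 1) + m.rk (Pi.single i 1) (m.covVec j m.lam)) := by
  have hadd : ∀ i (A B : Matrix ι ι 𝒜), m.covMat i (A + B) = m.covMat i A + m.covMat i B := by
    intro i A B
    have := m.covMat_sub i (A + B) B
    rw [add_sub_cancel_right] at this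
    rw [this, sub_add_cancel]
  rw [← m.covMat_comm, m.covMat_L, m.covMat_L, hadd, hadd]
  simp only [m.covMat_rk, covVec_single m i j]
  abel

theorem SA_ric_aux : (m.ric * m.L)ᵀ = m.ric * m.L := by
  ext j b
  have h1 : ∀ j b, (m.ric * m.L) j b = ∑ i, ((m.L * m.G) * m.low i j) i b
      + m.dv m.lam * m.g j b - Fintype.card ι * (m.g * m.cd m.lam) j b := by
    intro j b
    have e1 : (m.ric * m.L) j b = ∑ i, (m.curv i j * m.L) i b := by
      simp only [Matrix.mul_apply, MetricData.ric, of_apply, Finset.sum_mul]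
      exact Finset.sum_comm
    have e2 : ∀ i, (m.curv i j * m.L) i b = (m.L * m.curv i j) i b
        + (m.covVec i m.lam i * m.g b j + (Pi.single j 1 : ι → 𝒜) i * (m.g *ᵥ m.covVec i m.lam) b
         - (m.covVec j m.lam i * m.g b i + (m.g *ᵥ m.covVec j m.lam) b)) := by
      intro i
      have := congrFun (congrFun (m.curv_L i j) i) b
      simp only [Matrix.sub_apply, Matrix.add_apply, MetricData.rk, vecMulVec_apply,
        mulVec_single_one, col_apply, Pi.single_eq_same, one_mul] at this
      linear_combination this
    have hs : (m.g * m.cd m.lam) j b = (m.g *ᵥ m.covVec j m.lam) b := by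
      have : (m.g * m.cd m.lam)ᵀ = m.g * m.cd m.lam := by
        rw [transpose_mul, m.g_symm, m.SA_cd_lam]
      rw [← this]; rfl
    have e3 : ∑ i, (Pi.single j 1 : ι → 𝒜) i * (m.g *ᵥ m.covVec i m.lam) b
        = (m.g *ᵥ m.covVec j m.lam) b := by
      rw [Finset.sum_eq_single j] <;> simp +contextual
    have e4 : ∑ i, m.covVec j m.lam i * m.g b i = (m.g *ᵥ m.covVec j m.lam) b := by
      simp only [mulVec, dotProduct, mul_comm]
    have hg : m.g b j = m.g j b := congrFun (congrFun m.g_symm j) b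
    rw [e1, hs]
    simp only [e2, Finset.sum_add_distrib, Finset.sum_sub_distrib, e3, e4, ← Finset.sum_mul, hg]
    rw [m.dv_eq]
    simp only [m.curv_eq, Matrix.mul_assoc, Finset.sum_const, Finset.card_univ, nsmul_eq_mul]
    ring
  have hLG : (m.L * m.G)ᵀ = m.L * m.G := by
    calc (m.L * m.G)ᵀ = m.G * (m.Lᵀ * m.g) * m.G := by
          rw [transpose_mul, m.G_symm]
          simp only [Matrix.mul_assoc, m.g_mul_G, Matrix.mul_one]
      _ = _ := by
          rw [← m.SA_L, ← Matrix.mul_assoc, m.G_mul_g, Matrix.one_mul]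
  have hH : (m.g * m.cd m.lam) b j = (m.g * m.cd m.lam) j b := by
    have : (m.g * m.cd m.lam)ᵀ = m.g * m.cd m.lam := by
      rw [transpose_mul, m.g_symm, m.SA_cd_lam]
    exact congrFun (congrFun this j) b
  have hg : m.g b j = m.g j b := congrFun (congrFun m.g_symm j) b
  rw [transpose_apply, h1, h1, m.low_contract hLG, hH, hg]

theorem ric_L : m.ric * m.L = m.Lᵀ * m.ric := by
  rw [← m.SA_ric_aux, transpose_mul, m.ric_symm]

end BenentiData

namespace MetricData

variable {ι 𝒜 : Type*} [Fintype ι] [DecidableEq ι] [CommRing 𝒜] [Algebra ℝ 𝒜]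
variable (m : MetricData ι 𝒜)

/-- The endomorphism `X ↦ (∇_X M) v`. -/
def cm (M : Matrix ι ι 𝒜) (v : ι → 𝒜) : Matrix ι ι 𝒜 := of fun k i => (m.covMat i M *ᵥ v) k

theorem cd_mulVec_eq (M : Matrix ι ι 𝒜) (v : ι → 𝒜) :
    m.cd (M *ᵥ v) = M * m.cd v + m.cm M v := by
  ext k i
  have : (M * m.cd v) k i = (M *ᵥ m.covVec i v) k := rfl
  rw [Matrix.add_apply, this, cd, of_apply, covVec_mulVec, cm, of_apply, Pi.add_apply, add_comm]

theorem cm_mul (M N : Matrix ι ι 𝒜) (v : ι → 𝒜) :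
    m.cm (M * N) v = m.cm M (N *ᵥ v) + M * m.cm N v := by
  ext k i
  have : (M * m.cm N v) k i = (M *ᵥ (m.covMat i N *ᵥ v)) k := rfl
  rw [Matrix.add_apply, this, cm, of_apply, covMat_mul, cm, of_apply, add_mulVec, mulVec_mulVec,
    mulVec_mulVec, Pi.add_apply]

theorem cm_smul (a : 𝒜) (M : Matrix ι ι 𝒜) (v : ι → 𝒜) :
    m.cm (a • M) v = vecMulVec (M *ᵥ v) (m.df a) + a • m.cm M v := by
  ext k i
  simp only [cm, covMat_smul, add_mulVec, smul_mulVec, Matrix.add_apply, Matrix.smul_apply,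
    of_apply, Pi.add_apply, Pi.smul_apply, vecMulVec_apply, df, smul_eq_mul]
  ring

theorem df_bil (x y X : ι → 𝒜) :
    m.df (m.bil x y) ⬝ᵥ X = m.bil (m.cd x *ᵥ X) y + m.bil x (m.cd y *ᵥ X) := by
  have h : ∀ z : ι → 𝒜, m.cd z *ᵥ X = ∑ i, X i • m.covVec i z := by
    intro z
    ext j
    simp [cd, mulVec, dotProduct, mul_comm]
  have h1 : ∀ (f : ι → ι → 𝒜) (y : ι → 𝒜), m.bil (∑ i, f i) y = ∑ i, m.bil (f i) y := by
    intro f y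
    simp only [bil, sum_dotProduct]
  rw [h, h, h1, m.bil_comm x (∑ i, X i • m.covVec i y), h1]
  simp only [dotProduct, df, D_bil, bil_smul_left, ← Finset.sum_add_distrib]
  refine Finset.sum_congr rfl fun i _ => ?_
  rw [m.bil_comm (m.covVec i y) x]
  ring

theorem trace_mul_rk (M : Matrix ι ι 𝒜) (a b : ι → 𝒜) :
    (M * m.rk a b).trace = m.bil b (M *ᵥ a) := by
  rw [mul_rk, trace_rk, bil_comm]

theorem trace_SA_four {A N B M : Matrix ι ι 𝒜} (hA : m.SA A) (hN : m.SA N) (hB : m.SA B)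
    (hM : m.SA M) : (A * N * (B * M)).trace = (B * N * (A * M)).trace := by
  have conj : ∀ X : Matrix ι ι 𝒜, (m.G * X * m.g).trace = X.trace := by
    intro X
    rw [trace_mul_comm, ← Matrix.mul_assoc, m.g_mul_G, Matrix.one_mul]
  have h : ∀ {X : Matrix ι ι 𝒜}, m.SA X → Xᵀ = m.g * X * m.G := by
    intro X hX
    rw [hX, Matrix.mul_assoc, m.g_mul_G, Matrix.mul_one]
  have e : (A * N * (B * M))ᵀ = m.g * (M * B * N * A) * m.G := by
    simp only [transpose_mul, h hA, h hN, h hB, h hM]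
    have : ∀ X : Matrix ι ι 𝒜, m.G * (m.g * X) = X := by
      intro X; rw [← Matrix.mul_assoc, m.G_mul_g, Matrix.one_mul]
    simp only [Matrix.mul_assoc, this]
  rw [← trace_transpose, e, trace_mul_comm, ← Matrix.mul_assoc, m.G_mul_g, Matrix.one_mul,
    Matrix.mul_assoc, Matrix.mul_assoc, trace_mul_comm]
  simp only [Matrix.mul_assoc]

end MetricData

namespace BenentiData

variable {ι 𝒜 : Type*} [Fintype ι] [DecidableEq ι] [CommRing 𝒜] [Algebra ℝ 𝒜]
variable (m : BenentiData ι 𝒜)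

/-- The pencil `t - L`. -/
def pencil (t : ℝ) : Matrix ι ι 𝒜 := t • 1 - m.L

variable {m} {t s : ℝ} {R T : Matrix ι ι 𝒜}

theorem smul_one_comm (t : ℝ) (M : Matrix ι ι 𝒜) :
    (t • (1 : Matrix ι ι 𝒜)) * M = M * (t • (1 : Matrix ι ι 𝒜)) := by
  rw [Matrix.smul_mul, Matrix.mul_smul, Matrix.one_mul, Matrix.mul_one]

theorem SA_pencil : m.SA (m.pencil t) := by
  have h := m.SA_L
  rw [MetricData.SA] at h ⊢
  rw [pencil, Matrix.mul_sub, transpose_sub, Matrix.sub_mul, h, transpose_smul, transpose_one,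
    smul_one_comm]

theorem ric_pencil : m.ric * m.pencil t = (m.pencil t)ᵀ * m.ric := by
  rw [pencil, Matrix.mul_sub, transpose_sub, Matrix.sub_mul, m.ric_L, transpose_smul,
    transpose_one, smul_one_comm]

theorem ric_inv (hR : R * m.pencil t = 1) : m.ric * R = Rᵀ * m.ric := by
  have hR' : m.pencil t * R = 1 := mul_eq_one_comm.1 hR
  calc m.ric * R = (m.pencil t * R)ᵀ * (m.ric * R) := by
        rw [hR', transpose_one, Matrix.one_mul]
    _ = Rᵀ * ((m.pencil t)ᵀ * m.ric) * R := by rw [transpose_mul]; simp only [Matrix.mul_assoc]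
    _ = Rᵀ * m.ric * (m.pencil t * R) := by rw [← ric_pencil]; simp only [Matrix.mul_assoc]
    _ = _ := by rw [hR', Matrix.mul_one]

theorem pencil_sub : m.pencil t - m.pencil s = (t - s) • 1 := by
  rw [pencil, pencil, sub_smul]; abel

/-- The resolvent identity. -/
theorem resolvent (hR : R * m.pencil t = 1) (hT : T * m.pencil s = 1) :
    T = R + (t - s) • (R * T) := by
  have hT' : m.pencil s * T = 1 := mul_eq_one_comm.1 hT
  have : R * (m.pencil t - m.pencil s) * T = T - R := by
    rw [Matrix.mul_sub, Matrix.sub_mul, hR, Matrix.mul_assoc, hT', Matrix.one_mul, Matrix.mul_one]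
  rw [pencil_sub, Matrix.mul_smul, Matrix.mul_one, Matrix.smul_mul] at this
  rw [this]; abel

theorem resolvent_comm (hR : R * m.pencil t = 1) (hT : T * m.pencil s = 1) : R * T = T * R := by
  have hp : m.pencil t * m.pencil s = m.pencil s * m.pencil t := by
    have e : m.pencil t = m.pencil s + (t - s) • 1 := by rw [← pencil_sub]; abel
    rw [e, Matrix.add_mul, Matrix.mul_add, smul_one_comm]
  have hR' : m.pencil t * R = 1 := mul_eq_one_comm.1 hR
  have hT' : m.pencil s * T = 1 := mul_eq_one_comm.1 hT
  calc R * T = R * T * (m.pencil t * (m.pencil s * T) * R) := by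
        rw [hT', Matrix.mul_one, hR', Matrix.mul_one]
    _ = R * (T * (m.pencil t * m.pencil s)) * T * R := by simp only [Matrix.mul_assoc]
    _ = R * ((T * m.pencil s) * m.pencil t) * T * R := by
      rw [hp]; simp only [Matrix.mul_assoc]
    _ = T * R := by rw [hT, Matrix.one_mul, hR, Matrix.one_mul]

theorem covMat_pencil (i : ι) : m.covMat i (m.pencil t) = -m.covMat i m.L := by
  have : (t • (1 : Matrix ι ι 𝒜)) = (algebraMap ℝ 𝒜 t) • (1 : Matrix ι ι 𝒜) := by
    rw [algebraMap_smul]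
  rw [pencil, m.covMat_sub, this, m.covMat_smul, m.covMat_one]
  simp

theorem covMat_inv (hR : R * m.pencil t = 1) (i : ι) : m.covMat i R =
    m.rk (R *ᵥ m.lam) (R *ᵥ Pi.single i 1) + m.rk (R *ᵥ Pi.single i 1) (R *ᵥ m.lam) := by
  have hR' : m.pencil t * R = 1 := mul_eq_one_comm.1 hR
  have hS : m.SA R := SA_pencil.inv hR
  have h := m.covMat_mul i R (m.pencil t)
  rw [hR, m.covMat_one, covMat_pencil] at h
  have h2 : m.covMat i R = R * m.covMat i m.L * R := by
    calc m.covMat i R = m.covMat i R * (m.pencil t * R) := by rw [hR', Matrix.mul_one]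
      _ = (m.covMat i R * m.pencil t + R * -m.covMat i m.L) * R + R * m.covMat i m.L * R := by
        rw [Matrix.add_mul, Matrix.mul_neg, Matrix.neg_mul, ← Matrix.mul_assoc]; abel
      _ = _ := by rw [← h, Matrix.zero_mul, zero_add]
  rw [h2, m.covMat_L, Matrix.mul_add, Matrix.add_mul, m.mul_rk, m.mul_rk, m.rk_mul hS,
    m.rk_mul hS]

theorem cm_inv (hR : R * m.pencil t = 1) (v : ι → 𝒜) :
    m.cm R v = m.rk (R *ᵥ m.lam) (R *ᵥ v) + m.bil m.lam (R *ᵥ v) • R := by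
  have hS : m.SA R := SA_pencil.inv hR
  ext k i
  rw [MetricData.cm, of_apply, covMat_inv hR, add_mulVec, m.rk_mulVec, m.rk_mulVec,
    m.bil_mulVec hS, m.bil_mulVec hS, m.bil_comm (Pi.single i 1), bil_single, mulVec_single_one]
  simp only [Pi.add_apply, Pi.smul_apply, smul_eq_mul, Matrix.add_apply, Matrix.smul_apply,
    MetricData.rk, vecMulVec_apply, col_apply]
  ring

theorem df_det (hR : R * m.pencil t = 1) :
    m.df (m.pencil t).det = (-2 * (m.pencil t).det) • (m.g *ᵥ R *ᵥ m.lam) := by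
  have hS : m.SA R := SA_pencil.inv hR
  ext i
  have h1 : (R * m.covMat i (m.pencil t)).trace = (R * (m.pencil t).map (m.D i)).trace := by
    have e : (R * (m.Γ i * m.pencil t)).trace = (R * (m.pencil t * m.Γ i)).trace := by
      rw [← Matrix.mul_assoc, ← Matrix.mul_assoc, hR, Matrix.one_mul, trace_mul_comm,
        ← Matrix.mul_assoc, mul_eq_one_comm.1 hR, Matrix.one_mul]
    rw [MetricData.covMat, Matrix.mul_sub, Matrix.mul_add, trace_sub, trace_add, e,
      add_sub_cancel_right]
  rw [MetricData.df, leibniz_det_of_inv (m.D i) hR, ← h1, covMat_pencil, m.covMat_L,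
    Matrix.mul_neg, trace_neg, Matrix.mul_add, trace_add, m.mul_rk, m.mul_rk, m.trace_rk,
    m.trace_rk, m.bil_comm (R *ᵥ Pi.single i 1), m.bil_mulVec hS, ← m.bil_mulVec hS, bil_single,
    Pi.smul_apply, smul_eq_mul]
  ring

/-- The Killing tensor as an endomorphism. -/
theorem cd_killing (hR : R * m.pencil t = 1) {P : 𝒜} (hP : P = (m.pencil t).det) (v : ι → 𝒜) :
    m.cd ((P • R) *ᵥ v) = P • (R * m.cd v + ((-2 : 𝒜) • m.rk (R *ᵥ v) (R *ᵥ m.lam)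
      + m.rk (R *ᵥ m.lam) (R *ᵥ v) + m.bil m.lam (R *ᵥ v) • R)) := by
  subst hP
  rw [m.cd_mulVec_eq, m.cm_smul, cm_inv hR, df_det hR, vecMulVec_smul, Matrix.smul_mul]
  simp only [smul_add, smul_smul, MetricData.rk, mul_comm (-2 : 𝒜)]
  abel

end BenentiData

namespace MetricData

variable {ι 𝒜 : Type*} [Fintype ι] [DecidableEq ι] [CommRing 𝒜] [Algebra ℝ 𝒜]
variable (m : MetricData ι 𝒜)

/-- The zeroth order part of the covariant derivative of the Killing tensor
`det (t - L) (t - L)⁻¹`, where `R = (t - L)⁻¹`. -/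
def kill (lam : ι → 𝒜) (R : Matrix ι ι 𝒜) (v : ι → 𝒜) : Matrix ι ι 𝒜 :=
  (-2 : 𝒜) • m.rk (R *ᵥ v) (R *ᵥ lam) + m.rk (R *ᵥ lam) (R *ᵥ v) + m.bil lam (R *ᵥ v) • R

variable {m} {lam u v : ι → 𝒜} {R T Z N M : Matrix ι ι 𝒜} {τ : 𝒜}

theorem trace_mul_kill (hR : m.SA R) (hT : m.SA T) (hN : m.SA N) (hZ : R * T = Z)
    (hZ' : T * R = Z) :
    (R * N * m.kill lam T v).trace = -2 * m.bil lam ((Z * N * T) *ᵥ v)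
      + m.bil lam ((T * N * Z) *ᵥ v) + m.bil lam (T *ᵥ v) * (Z * N).trace := by
  have e1 : m.bil (T *ᵥ lam) ((R * N) *ᵥ T *ᵥ v) = m.bil lam ((Z * N * T) *ᵥ v) := by
    rw [m.bil_mulVec hT]; simp only [mulVec_mulVec, ← Matrix.mul_assoc, hZ']
  have e2 : m.bil (T *ᵥ v) ((R * N) *ᵥ T *ᵥ lam) = m.bil lam ((T * N * Z) *ᵥ v) := by
    rw [← mulVec_mulVec, ← m.bil_mulVec hR, ← m.bil_mulVec hN, ← m.bil_mulVec hT, m.bil_comm]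
    simp only [mulVec_mulVec, Matrix.mul_assoc, hZ]
  have e3 : (R * N * T).trace = (Z * N).trace := by
    rw [trace_mul_comm, ← Matrix.mul_assoc, hZ']
  rw [kill, Matrix.mul_add, Matrix.mul_add, Matrix.mul_smul, Matrix.mul_smul, trace_add, trace_add,
    trace_smul, trace_smul, trace_mul_rk, trace_mul_rk, e1, e2, e3, smul_eq_mul, smul_eq_mul]

theorem trace_mul_kill_sub (hR : m.SA R) (hT : m.SA T) (hN : m.SA N) (hZ : R * T = Z)
    (hZ' : T * R = Z) (hτ : T = R + τ • Z) :
    (R * N * m.kill lam T v).trace - (T * N * m.kill lam R v).trace =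
      τ * (m.bil lam (Z *ᵥ v) * (Z * N).trace - m.bil lam ((Z * N * Z) *ᵥ v)) := by
  rw [trace_mul_kill hR hT hN hZ hZ', trace_mul_kill hT hR hN hZ' hZ]
  have e1 : m.bil lam ((Z * N * T) *ᵥ v)
      = m.bil lam ((Z * N * R) *ᵥ v) + τ * m.bil lam ((Z * N * Z) *ᵥ v) := by
    rw [← m.bil_smul_right, ← m.bil_add_right, ← smul_mulVec, ← add_mulVec, ← Matrix.mul_smul,
      ← Matrix.mul_add, ← hτ]
  have e2 : m.bil lam ((T * N * Z) *ᵥ v)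
      = m.bil lam ((R * N * Z) *ᵥ v) + τ * m.bil lam ((Z * N * Z) *ᵥ v) := by
    rw [← m.bil_smul_right, ← m.bil_add_right, ← smul_mulVec, ← add_mulVec, ← Matrix.smul_mul,
      ← Matrix.smul_mul, ← Matrix.add_mul, ← Matrix.add_mul, ← hτ]
  have e3 : m.bil lam (T *ᵥ v) = m.bil lam (R *ᵥ v) + τ * m.bil lam (Z *ᵥ v) := by
    rw [← m.bil_smul_right, ← m.bil_add_right, ← smul_mulVec, ← add_mulVec, ← hτ]
  rw [e1, e2, e3]; ring

theorem trace_kill_mul_kill (hR : m.SA R) (hT : m.SA T) (hZ : R * T = Z) (hZ' : T * R = Z) :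
    (m.kill lam R u * m.kill lam T v).trace = 5 * (m.bil lam (Z *ᵥ u) * m.bil lam (Z *ᵥ v))
      - 4 * (m.bil lam (Z *ᵥ lam) * m.bil u (Z *ᵥ v))
      - m.bil lam (T *ᵥ v) * m.bil lam ((R * Z) *ᵥ u)
      - m.bil lam (R *ᵥ u) * m.bil lam ((T * Z) *ᵥ v)
      + m.bil lam (R *ᵥ u) * m.bil lam (T *ᵥ v) * Z.trace := by
  have a1 : ∀ x y, m.bil (R *ᵥ x) (T *ᵥ y) = m.bil x (Z *ᵥ y) := by
    intro x y; rw [m.bil_mulVec hR, mulVec_mulVec, hZ]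
  have a2 : ∀ x y, m.bil x (Z *ᵥ y) = m.bil y (Z *ᵥ x) := by
    intro x y; rw [← a1, m.bil_comm, m.bil_mulVec hT, mulVec_mulVec, hZ']
  have a3 : ∀ x y, m.bil (R *ᵥ x) (T *ᵥ R *ᵥ y) = m.bil x ((R * Z) *ᵥ y) := by
    intro x y; rw [mulVec_mulVec, hZ', m.bil_mulVec hR, mulVec_mulVec]
  have a4 : ∀ x y, m.bil (T *ᵥ x) (R *ᵥ T *ᵥ y) = m.bil x ((T * Z) *ᵥ y) := by
    intro x y; rw [mulVec_mulVec, hZ, m.bil_mulVec hT, mulVec_mulVec]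
  have a5 : ∀ x y, m.bil (R *ᵥ x) (T *ᵥ R *ᵥ y) = m.bil (R *ᵥ y) (T *ᵥ R *ᵥ x) := by
    intro x y; rw [← m.bil_mulVec hT, m.bil_comm]
  have a6 : ∀ x y, m.bil (T *ᵥ x) (R *ᵥ T *ᵥ y) = m.bil (T *ᵥ y) (R *ᵥ T *ᵥ x) := by
    intro x y; rw [← m.bil_mulVec hR, m.bil_comm]
  simp only [kill, Matrix.mul_add, Matrix.add_mul, trace_add, Matrix.mul_smul, Matrix.smul_mul,
    trace_smul, smul_eq_mul, m.trace_rk, m.mul_rk, m.rk_mul hT, hZ, add_mulVec, smul_mulVec,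
    m.rk_mulVec, m.bil_add_left, m.bil_smul_left]
  rw [a5 u lam, a3, m.bil_comm (R *ᵥ T *ᵥ v), a4 lam v, m.bil_comm (R *ᵥ T *ᵥ lam), a6 v lam, a4]
  simp only [a1]
  rw [a2 u lam]
  ring

end MetricData

namespace BenentiData

variable {ι 𝒜 : Type*} [Fintype ι] [DecidableEq ι] [CommRing 𝒜] [Algebra ℝ 𝒜]
variable {m : BenentiData ι 𝒜} {t s : ℝ} {R T : Matrix ι ι 𝒜} {u v : ι → 𝒜}

theorem trace_cd_killing (hR : R * m.pencil t = 1) (hT : T * m.pencil s = 1)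
    (hu : m.SA (m.cd u)) (hv : m.SA (m.cd v)) {P Q τ : 𝒜}
    (hP : P = (m.pencil t).det) (hQ : Q = (m.pencil s).det) (hτ : T = R + τ • (R * T)) :
    (m.cd ((P • R) *ᵥ u) * m.cd ((Q • T) *ᵥ v)).trace
      - (m.cd ((Q • T) *ᵥ u) * m.cd ((P • R) *ᵥ v)).trace = P * Q * τ *
      ((m.bil m.lam ((R * T) *ᵥ v) * ((R * T) * m.cd u).trace
          - m.bil m.lam (((R * T) * m.cd u * (R * T)) *ᵥ v))
        - (m.bil m.lam ((R * T) *ᵥ u) * ((R * T) * m.cd v).trace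
          - m.bil m.lam (((R * T) * m.cd v * (R * T)) *ᵥ u))
        + (m.bil m.lam ((T * (R * T)) *ᵥ v) * m.bil m.lam ((R * T) *ᵥ u)
          - m.bil m.lam ((T * (R * T)) *ᵥ u) * m.bil m.lam ((R * T) *ᵥ v)
          + (R * T).trace * (m.bil m.lam (T *ᵥ u) * m.bil m.lam ((R * T) *ᵥ v)
            - m.bil m.lam (T *ᵥ v) * m.bil m.lam ((R * T) *ᵥ u))
          + m.bil m.lam (((R * T) * (R * T)) *ᵥ u) * m.bil m.lam (T *ᵥ v)
          - m.bil m.lam (((R * T) * (R * T)) *ᵥ v) * m.bil m.lam (T *ᵥ u))) := by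
  have hSR : m.SA R := SA_pencil.inv hR
  have hST : m.SA T := SA_pencil.inv hT
  have hZ' := (resolvent_comm hR hT).symm
  have k1 : ∀ w, m.cd ((P • R) *ᵥ w) = P • (R * m.cd w + m.kill m.lam R w) :=
    fun w => cd_killing hR hP w
  have k2 : ∀ w, m.cd ((Q • T) *ᵥ w) = Q • (T * m.cd w + m.kill m.lam T w) :=
    fun w => cd_killing hT hQ w
  have n1 := m.trace_SA_four hSR hu hST hv
  have n2 := MetricData.trace_mul_kill_sub (lam := m.lam) (v := v) hSR hST hu rfl hZ' hτ
  have n3 := MetricData.trace_mul_kill_sub (lam := m.lam) (v := u) hSR hST hv rfl hZ' hτ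
  have n4 := MetricData.trace_kill_mul_kill (lam := m.lam) (u := u) (v := v) hSR hST rfl hZ'
  have n5 := MetricData.trace_kill_mul_kill (lam := m.lam) (u := u) (v := v) hST hSR hZ' rfl
  have e1 : ∀ w, m.bil m.lam (T *ᵥ w)
      = m.bil m.lam (R *ᵥ w) + τ * m.bil m.lam ((R * T) *ᵥ w) := by
    intro w
    rw [← m.bil_smul_right, ← m.bil_add_right, ← smul_mulVec, ← add_mulVec, ← hτ]
  have e2 : ∀ w, m.bil m.lam ((T * (R * T)) *ᵥ w) = m.bil m.lam ((R * (R * T)) *ᵥ w)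
      + τ * m.bil m.lam (((R * T) * (R * T)) *ᵥ w) := by
    intro w
    rw [← m.bil_smul_right, ← m.bil_add_right, ← smul_mulVec, ← add_mulVec, ← Matrix.smul_mul,
      ← Matrix.add_mul, ← hτ]
  simp only [k1, k2, Matrix.smul_mul, Matrix.mul_smul, trace_smul, smul_eq_mul, Matrix.add_mul,
    Matrix.mul_add, trace_add]
  rw [trace_mul_comm (m.kill m.lam R u) (T * m.cd v), trace_mul_comm (m.kill m.lam T u) (R * m.cd v),
    n1, n4, n5]
  rw [e2, e2] at *
  rw [e1, e1] at *
  linear_combination P * Q * n2 - P * Q * n3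

theorem cm_mul_inv (hR : R * m.pencil t = 1) (hT : T * m.pencil s = 1) (v : ι → 𝒜) :
    m.cm (R * T) v = m.rk (R *ᵥ m.lam) ((R * T) *ᵥ v) + m.bil m.lam ((R * T) *ᵥ v) • R
      + (m.rk ((R * T) *ᵥ m.lam) (T *ᵥ v) + m.bil m.lam (T *ᵥ v) • (R * T)) := by
  rw [m.cm_mul, cm_inv hR, cm_inv hT, Matrix.mul_add, m.mul_rk, Matrix.mul_smul]
  simp only [mulVec_mulVec]

theorem dv_bil_smul (hR : R * m.pencil t = 1) (hT : T * m.pencil s = 1) :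
    m.dv (m.bil m.lam ((R * T) *ᵥ v) • (R * T) *ᵥ u)
      = m.bil (m.cd m.lam *ᵥ (R * T) *ᵥ u) ((R * T) *ᵥ v)
      + m.bil m.lam (((R * T) * m.cd v * (R * T)) *ᵥ u)
      + m.bil m.lam (R *ᵥ m.lam) * m.bil ((R * T) *ᵥ v) ((R * T) *ᵥ u)
      + m.bil m.lam ((R * T) *ᵥ v) * m.bil m.lam ((R * (R * T)) *ᵥ u)
      + m.bil m.lam ((R * T) *ᵥ m.lam) * m.bil v ((T * (R * T)) *ᵥ u)
      + m.bil m.lam (T *ᵥ v) * m.bil m.lam (((R * T) * (R * T)) *ᵥ u)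
      + m.bil m.lam ((R * T) *ᵥ v) * (((R * T) * m.cd u).trace
        + m.bil m.lam ((R * (R * T)) *ᵥ u) + m.bil m.lam ((R * T) *ᵥ u) * R.trace
        + m.bil m.lam ((T * (R * T)) *ᵥ u) + m.bil m.lam (T *ᵥ u) * (R * T).trace) := by
  have hSR : m.SA R := SA_pencil.inv hR
  have hST : m.SA T := SA_pencil.inv hT
  have hc := resolvent_comm hR hT
  have hSZ : m.SA (R * T) := hSR.mul hST hc
  have e : T * (R * T) = R * (T * T) := by rw [← Matrix.mul_assoc, ← hc, Matrix.mul_assoc]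
  rw [m.dv_smul, m.df_bil, m.cd_mulVec_eq, MetricData.dv, m.cd_mulVec_eq, cm_mul_inv hR hT,
    cm_mul_inv hR hT]
  simp only [add_mulVec, trace_add, trace_smul, m.trace_rk, m.rk_mulVec, smul_mulVec,
    m.bil_add_right, m.bil_smul_right, smul_eq_mul]
  rw [m.bil_mulVec hSR, m.bil_mulVec hSZ m.lam, m.bil_mulVec hST]
  simp only [mulVec_mulVec, e, Matrix.mul_assoc]
  ring

theorem dv_correction (hR : R * m.pencil t = 1) (hT : T * m.pencil s = 1) {P Q τ : 𝒜}
    (hP : P = (m.pencil t).det) (hQ : Q = (m.pencil s).det) (hτ' : ∀ i, m.D i τ = 0) :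
    m.dv ((P * Q * τ) • (m.bil m.lam ((R * T) *ᵥ v) • (R * T) *ᵥ u
        - m.bil m.lam ((R * T) *ᵥ u) • (R * T) *ᵥ v)) = P * Q * τ *
      ((m.bil m.lam ((R * T) *ᵥ v) * ((R * T) * m.cd u).trace
          - m.bil m.lam (((R * T) * m.cd u * (R * T)) *ᵥ v))
        - (m.bil m.lam ((R * T) *ᵥ u) * ((R * T) * m.cd v).trace
          - m.bil m.lam (((R * T) * m.cd v * (R * T)) *ᵥ u))
        + (m.bil m.lam ((T * (R * T)) *ᵥ v) * m.bil m.lam ((R * T) *ᵥ u)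
          - m.bil m.lam ((T * (R * T)) *ᵥ u) * m.bil m.lam ((R * T) *ᵥ v)
          + (R * T).trace * (m.bil m.lam (T *ᵥ u) * m.bil m.lam ((R * T) *ᵥ v)
            - m.bil m.lam (T *ᵥ v) * m.bil m.lam ((R * T) *ᵥ u))
          + m.bil m.lam (((R * T) * (R * T)) *ᵥ u) * m.bil m.lam (T *ᵥ v)
          - m.bil m.lam (((R * T) * (R * T)) *ᵥ v) * m.bil m.lam (T *ᵥ u))) := by
  have hSR : m.SA R := SA_pencil.inv hR
  have hST : m.SA T := SA_pencil.inv hT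
  have hc := resolvent_comm hR hT
  have hSZ : m.SA (R * T) := hSR.mul hST hc
  have hSTZ : m.SA (T * (R * T)) := hST.mul hSZ (by rw [hc, Matrix.mul_assoc, ← hc])
  have hdf : ∀ X, m.df (P * Q * τ) ⬝ᵥ X
      = -2 * (P * Q * τ) * (m.bil m.lam (R *ᵥ X) + m.bil m.lam (T *ᵥ X)) := by
    intro X
    have h1 : m.df (P * Q * τ) = (Q * τ) • m.df P + (P * τ) • m.df Q := by
      ext i
      simp only [MetricData.df, leibniz_mul, hτ', Pi.add_apply, Pi.smul_apply, smul_eq_mul]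
      ring
    have h2 : ∀ w, (m.g *ᵥ w) ⬝ᵥ X = m.bil w X := by
      intro w; rw [m.bil_comm, dotProduct_comm, MetricData.bil]
    rw [h1, hP, hQ, df_det hR, df_det hT]
    simp only [add_dotProduct, smul_dotProduct, smul_eq_mul, h2, m.bil_mulVec hSR,
      m.bil_mulVec hST]
    ring
  have s1 : m.bil (m.cd m.lam *ᵥ (R * T) *ᵥ v) ((R * T) *ᵥ u)
      = m.bil (m.cd m.lam *ᵥ (R * T) *ᵥ u) ((R * T) *ᵥ v) := by
    rw [m.bil_mulVec m.SA_cd_lam, m.bil_comm]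
  have s2 : m.bil u ((T * (R * T)) *ᵥ v) = m.bil v ((T * (R * T)) *ᵥ u) := by
    rw [m.bil_comm, m.bil_mulVec hSTZ]
  rw [m.dv_smul, hdf, m.dv_sub, dv_bil_smul hR hT, dv_bil_smul hR hT, s1, s2,
    m.bil_comm ((R * T) *ᵥ u) ((R * T) *ᵥ v)]
  simp only [sub_eq_add_neg, mulVec_add, mulVec_neg, mulVec_smul]
  simp only [← neg_smul, m.bil_add_right, m.bil_smul_right, mulVec_mulVec]
  ring

end BenentiData

namespace MetricData

variable {ι 𝒜 : Type*} [Fintype ι] [DecidableEq ι] [CommRing 𝒜] [Algebra ℝ 𝒜]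
variable (m : MetricData ι 𝒜)

/-- The divergence expressed through a density. -/
theorem density_mul_dv {w : 𝒜} (hw : ∀ i, m.D i w = w * (m.Γ i).trace) (X : ι → 𝒜) :
    w * m.dv X = ∑ i, m.D i (w * X i) := by
  have h : ∑ i, (m.Γ i *ᵥ X) i = ∑ i, (m.Γ i).trace * X i := by
    simp only [mulVec, dotProduct, trace, diag_apply, Finset.sum_mul]
    rw [Finset.sum_comm]
    exact Finset.sum_congr rfl fun i _ => Finset.sum_congr rfl fun j _ => by rw [m.torsion]
  simp only [leibniz_mul, hw, Finset.sum_add_distrib, dv_eq, covVec, Pi.add_apply, h, mul_add,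
    Finset.mul_sum, mul_assoc]
  rw [add_comm]

theorem eq_zero_of_forall_mul_eq_dv {w w' : 𝒜} (hww : w' * w = 1)
    (hw : ∀ i, m.D i w = w * (m.Γ i).trace) {x : ι → 𝒜}
    (hx : ∀ i j, m.D i (x j) = if i = j then 1 else 0) {c : 𝒜} {α : Matrix ι ι 𝒜} {β : ι → 𝒜}
    (h : ∀ a, a * c = m.dv (α *ᵥ m.df a + a • β)) : c = 0 := by
  have h1 : m.dv β = c := by
    have := h 1
    have h0 : m.df 1 = 0 := by ext; simp [df]
    simpa [h0] using this.symm
  have h2 : ∀ a, m.dv (α *ᵥ m.df a) + m.df a ⬝ᵥ β = 0 := by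
    intro a
    have := h a
    rw [dv_add, dv_smul, h1] at this
    linear_combination -this
  have h3 : ∀ a, m.dv (α *ᵥ m.df a)
      = ∑ j, (∑ i, m.D i (m.D j a) * α i j + m.D j a * m.dv (α.col j)) := by
    intro a
    have e : α *ᵥ m.df a = ∑ j, m.D j a • α.col j := by
      ext k
      simp [mulVec, dotProduct, df, mul_comm]
    rw [e, dv_eq]
    simp only [covVec_sum, Finset.sum_apply]
    rw [Finset.sum_comm]
    refine Finset.sum_congr rfl fun j _ => ?_
    rw [← dv_eq, dv_smul]
    rfl
  have h4 : ∀ j, m.dv (α.col j) + β j = 0 := by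
    intro j
    have := h2 (x j)
    rw [h3] at this
    have e : ∀ i k, m.D i (m.D k (x j)) = 0 := by
      intro i k; rw [hx]; split_ifs <;> simp
    simp only [e, zero_mul, Finset.sum_const_zero, zero_add] at this
    simpa [hx, dotProduct, df] using this
  have h5 : ∀ a, ∑ j, ∑ i, m.D i (m.D j a) * α i j = 0 := by
    intro a
    have := h2 a
    rw [h3, Finset.sum_add_distrib] at this
    have e : ∀ j, m.dv (α.col j) = -β j := fun j => eq_neg_of_add_eq_zero_left (h4 j)
    simpa [e, dotProduct, df] using this
  have h6 : ∀ j k, α j k + α k j = 0 := by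
    intro j k
    have := h5 (x j * x k)
    have e : ∀ a i, m.D i (m.D a (x j * x k)) = (if a = j then 1 else 0) * (if i = k then 1 else 0)
        + (if i = j then 1 else 0) * (if a = k then 1 else 0) := by
      intro a i
      have e0 : ∀ i a k : ι, m.D i (if a = k then 1 else 0) = 0 := by
        intro i a k; split_ifs <;> simp
      simp only [leibniz_mul, map_add, hx, e0]
      ring
    simp only [e, add_mul, Finset.sum_add_distrib] at this
    simpa [add_comm] using this
  have h7 : w * c = -∑ j, ∑ i, m.D j (m.D i (w * α i j)) := by
    rw [← h1, m.density_mul_dv hw, ← Finset.sum_neg_distrib]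
    refine Finset.sum_congr rfl fun j _ => ?_
    have e : w * β j = -∑ i, m.D i (w * α i j) := by
      rw [eq_neg_of_add_eq_zero_right (h4 j), mul_neg, m.density_mul_dv hw]
      rfl
    rw [e, map_neg, map_sum]
  have h8 : w * c = 0 := by
    apply eq_zero_of_two_mul
    rw [two_mul]
    nth_rewrite 2 [h7]
    rw [Finset.sum_comm, h7, ← neg_add, ← Finset.sum_add_distrib, neg_eq_zero]
    refine Finset.sum_eq_zero fun j _ => ?_
    rw [← Finset.sum_add_distrib]
    refine Finset.sum_eq_zero fun i _ => ?_
    rw [m.D_comm i j, ← map_add, ← map_add, ← mul_add, h6, mul_zero, map_zero, map_zero]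
  calc c = w' * w * c := by rw [hww, one_mul]
    _ = 0 := by rw [mul_assoc, h8, mul_zero]

/-- The gradient of a function. -/
def grad (a : 𝒜) : ι → 𝒜 := m.G *ᵥ m.df a

/-- The second order operator associated with an endomorphism field. -/
def op (A : Matrix ι ι 𝒜) (a : 𝒜) : 𝒜 := m.dv (A *ᵥ m.grad a)

theorem g_mulVec_grad (a : 𝒜) : m.g *ᵥ m.grad a = m.df a := by
  rw [grad, mulVec_mulVec, m.g_mul_G, one_mulVec]

theorem SA_cd_grad (a : 𝒜) : m.SA (m.cd (m.grad a)) := by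
  refine m.SA_cd fun i j => ?_
  simp only [g_mulVec_grad, df, m.D_comm i j]

theorem df_dotProduct (a : 𝒜) (X : ι → 𝒜) : m.df a ⬝ᵥ X = m.bil X (m.grad a) := by
  rw [bil, g_mulVec_grad, dotProduct_comm]

/-- Green's identity. -/
theorem mul_op {A : Matrix ι ι 𝒜} (hA : m.SA A) (a b : 𝒜) :
    a * m.op A b = b * m.op A a + m.dv (a • A *ᵥ m.grad b - b • A *ᵥ m.grad a) := by
  rw [dv_sub, dv_smul, dv_smul, df_dotProduct, df_dotProduct, m.bil_mulVec hA (m.grad b),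
    m.bil_comm (m.grad b), op, op]
  ring

end MetricData

namespace BenentiData

variable {ι 𝒜 : Type*} [Fintype ι] [DecidableEq ι] [CommRing 𝒜] [Algebra ℝ 𝒜]
variable {m : BenentiData ι 𝒜} {t s : ℝ} {R T : Matrix ι ι 𝒜} {u v : ι → 𝒜}

theorem dv_killing_mul_dv (hR : R * m.pencil t = 1) (hT : T * m.pencil s = 1)
    (hu : m.SA (m.cd u)) (hv : m.SA (m.cd v)) {A B : Matrix ι ι 𝒜}
    (hA : A = (m.pencil t).det • R) (hB : B = (m.pencil s).det • T) :
    m.dv (A *ᵥ u) * m.dv (B *ᵥ v) - m.dv (B *ᵥ u) * m.dv (A *ᵥ v) =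
      m.dv ((m.dv (B *ᵥ v) • A *ᵥ u - m.cd (B *ᵥ v) *ᵥ A *ᵥ u)
        - (m.dv (A *ᵥ v) • B *ᵥ u - m.cd (A *ᵥ v) *ᵥ B *ᵥ u)
        + ((m.pencil t).det * (m.pencil s).det * algebraMap ℝ 𝒜 (t - s)) •
          (m.bil m.lam ((R * T) *ᵥ v) • (R * T) *ᵥ u
            - m.bil m.lam ((R * T) *ᵥ u) • (R * T) *ᵥ v)) := by
  have hτ : T = R + algebraMap ℝ 𝒜 (t - s) • (R * T) := by
    rw [algebraMap_smul]; exact resolvent hR hT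
  have h1 := trace_cd_killing hR hT hu hv rfl rfl hτ
  rw [← dv_correction (u := u) (v := v) hR hT rfl rfl (fun i => by simp), ← hA, ← hB] at h1
  have hric : (A *ᵥ u) ⬝ᵥ m.ric *ᵥ B *ᵥ v = (B *ᵥ u) ⬝ᵥ m.ric *ᵥ A *ᵥ v := by
    have e : ∀ C D : Matrix ι ι 𝒜, m.ric * C = Cᵀ * m.ric →
        (C *ᵥ u) ⬝ᵥ m.ric *ᵥ D *ᵥ v = u ⬝ᵥ (m.ric * (C * D)) *ᵥ v := by
      intro C D hC
      rw [← vecMul_transpose, ← dotProduct_mulVec, mulVec_mulVec, mulVec_mulVec, ← hC,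
        Matrix.mul_assoc]
    have hc : A * B = B * A := by
      rw [hA, hB, Matrix.smul_mul, Matrix.mul_smul, Matrix.smul_mul, Matrix.mul_smul,
        resolvent_comm hR hT, smul_comm]
    rw [e, e, hc]
    · rw [hB, Matrix.mul_smul, transpose_smul, Matrix.smul_mul, ric_inv hT]
    · rw [hA, Matrix.mul_smul, transpose_smul, Matrix.smul_mul, ric_inv hR]
  rw [m.dv_add, m.dv_sub, m.dv_mul_dv, m.dv_mul_dv, hric, ← h1]
  ring

theorem op_comm {w w' : 𝒜} (hww : w' * w = 1) (hw : ∀ i, m.D i w = w * (m.Γ i).trace)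
    {x : ι → 𝒜} (hx : ∀ i j, m.D i (x j) = if i = j then 1 else 0)
    (hR : R * m.pencil t = 1) (hT : T * m.pencil s = 1) {A B : Matrix ι ι 𝒜}
    (hA : A = (m.pencil t).det • R) (hB : B = (m.pencil s).det • T) (f : 𝒜) :
    m.op A (m.op B f) = m.op B (m.op A f) := by
  have hSA : ∀ {a : 𝒜} {C : Matrix ι ι 𝒜}, m.SA C → m.SA (a • C) := by
    intro a C h
    rw [MetricData.SA, Matrix.mul_smul, transpose_smul, Matrix.smul_mul, h]
  have hAS : m.SA A := hA ▸ hSA (SA_pencil.inv hR)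
  have hBS : m.SA B := hB ▸ hSA (SA_pencil.inv hT)
  rw [← sub_eq_zero]
  set c := (m.pencil t).det * (m.pencil s).det * algebraMap ℝ 𝒜 (t - s)
  set v := m.grad f with hv
  refine m.eq_zero_of_forall_mul_eq_dv hww hw hx
    (α := (m.cd (A *ᵥ v) * B - m.cd (B *ᵥ v) * A + c • (m.bil m.lam ((R * T) *ᵥ v) • (R * T)
      - m.rk ((R * T) *ᵥ v) ((R * T) *ᵥ m.lam))) * m.G)
    (β := A *ᵥ m.grad (m.op B f) - B *ᵥ m.grad (m.op A f)) fun a => ?_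
  have hSZ : m.SA (R * T) := (SA_pencil.inv hR).mul (SA_pencil.inv hT) (resolvent_comm hR hT)
  have key := dv_killing_mul_dv hR hT (m.SA_cd_grad a) (m.SA_cd_grad f) hA hB
  rw [← mulVec_mulVec]
  change _ = m.dv (_ *ᵥ m.grad a + _)
  rw [mul_sub, m.mul_op hAS, m.mul_op hBS]
  have e : m.op B f * m.op A a - m.op A f * m.op B a
      = m.dv (A *ᵥ m.grad a) * m.dv (B *ᵥ v) - m.dv (B *ᵥ m.grad a) * m.dv (A *ᵥ v) := by
    simp only [MetricData.op, ← hv]; ring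
  calc _ = m.op B f * m.op A a - m.op A f * m.op B a
      + (m.dv (a • A *ᵥ m.grad (m.op B f) - m.op B f • A *ᵥ m.grad a)
      - m.dv (a • B *ᵥ m.grad (m.op A f) - m.op A f • B *ᵥ m.grad a)) := by ring
    _ = _ := by
      rw [e, key, ← m.dv_sub, ← m.dv_add]
      congr 1
      have e1 : m.op B f = m.dv (B *ᵥ v) := rfl
      have e2 : m.op A f = m.dv (A *ᵥ v) := rfl
      rw [e1, e2]
      simp only [add_mulVec, sub_mulVec, smul_mulVec, m.rk_mulVec, m.bil_mulVec hSZ, smul_sub,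
        mulVec_mulVec]
      abel

end BenentiData

section LeviCivita

variable {ι 𝒜 : Type*} [Fintype ι] [DecidableEq ι] [CommRing 𝒜] [Algebra ℝ 𝒜]

/-- Christoffel symbols; `christoffel D g G i k j` has upper index `k`. -/
noncomputable def christoffel (D : ι → Derivation ℝ 𝒜 𝒜) (g G : Matrix ι ι 𝒜) (i : ι) :
    Matrix ι ι 𝒜 :=
  of fun k j => (1 / 2 : ℝ) • ∑ l, G k l * (D i (g l j) + D j (g l i) - D l (g i j))

/-- The Levi-Civita connection of an invertible symmetric matrix. -/
noncomputable def leviCivita (D : ι → Derivation ℝ 𝒜 𝒜) (hD : ∀ i j a, D i (D j a) = D j (D i a))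
    {g G : Matrix ι ι 𝒜} (hg : gᵀ = g) (hG : g * G = 1) : MetricData ι 𝒜 where
  D := D
  D_comm := hD
  g := g
  G := G
  Γ := christoffel D g G
  g_symm := hg
  g_mul_G := hG
  torsion i j k := by
    have h : g i j = g j i := congrFun (congrFun hg j) i
    simp only [christoffel, of_apply, h]
    congr 1
    exact Finset.sum_congr rfl fun l _ => by ring
  compat i := by
    have h : ∀ a b, g a b = g b a := fun a b => congrFun (congrFun hg b) a
    have e : ∀ j k, (g * christoffel D g G i) j k
        = (1 / 2 : ℝ) • (D i (g j k) + D k (g j i) - D j (g i k)) := by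
      intro j k
      have e1 : (fun l => christoffel D g G i l k) = (1 / 2 : ℝ) •
          G *ᵥ fun l => D i (g l k) + D k (g l i) - D l (g i k) := rfl
      have e2 : (g * christoffel D g G i) j k = (g *ᵥ fun l => christoffel D g G i l k) j := rfl
      rw [e2, e1, mulVec_smul, mulVec_mulVec, hG, one_mulVec]
      rfl
    have e2 : ((christoffel D g G i)ᵀ * g) = (g * christoffel D g G i)ᵀ := by
      rw [transpose_mul, hg]
    ext j k
    rw [e2, Matrix.add_apply, transpose_apply, e, e, ← smul_add, map_apply, h k j, h k i, h i j]
    have e3 : D i (g j k) + D k (g j i) - D j (g i k)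
        + (D i (g j k) + D j (g i k) - D k (g j i)) = (2 : ℝ) • D i (g j k) := by
      rw [two_smul]; ring
    rw [e3, smul_smul]
    norm_num

end LeviCivita

/-- The logarithmic derivative of a root. -/
theorem leibniz_root {𝒜 : Type*} [CommRing 𝒜] [Algebra ℝ 𝒜] (δ : Derivation ℝ 𝒜 𝒜)
    {w a b b' α β : 𝒜} {k : ℕ} (hb : b' * b = 1) (h : w ^ (2 * k) * a ^ 2 = b ^ 2)
    (ha : δ a = 2 * a * α) (hb' : δ b = 2 * b * β) :
    (k : 𝒜) * δ w = 2 * w * (β - α) := by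
  have h1 := congrArg δ h
  have h2 : w * δ (w ^ (2 * k)) = 2 * k * w ^ (2 * k) * δ w := by
    rw [δ.leibniz_pow]
    rcases k with _ | k
    · simp
    · have : 2 * (k + 1) - 1 = 2 * k + 1 := by omega
      rw [this, smul_eq_mul, nsmul_eq_mul]
      push_cast
      ring
  rw [pow_two a, pow_two b, leibniz_mul, leibniz_mul, leibniz_mul, ha, hb'] at h1
  apply eq_of_two_mul
  have h3 : b ^ 2 * (2 * (k * δ w) - 2 * (2 * w * (β - α))) = 0 := by
    linear_combination w * h1 - a ^ 2 * h2 - (4 * w * α + 2 * k * δ w) * h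
  have h4 : b' ^ 2 * b ^ 2 = 1 := by rw [← mul_pow, hb, one_pow]
  linear_combination b' ^ 2 * h3 - (2 * (k * δ w) - 2 * (2 * w * (β - α))) * h4

namespace MetricData

variable {ι 𝒜 : Type*} [Fintype ι] [DecidableEq ι] [CommRing 𝒜] [Algebra ℝ 𝒜]
variable (m : MetricData ι 𝒜)

theorem D_det (i : ι) : m.D i m.g.det = 2 * m.g.det * (m.Γ i).trace := by
  rw [leibniz_det_of_inv (m.D i) m.G_mul_g, m.compat, Matrix.mul_add, trace_add,
    ← Matrix.mul_assoc, m.G_mul_g, Matrix.one_mul, ← Matrix.mul_assoc, trace_mul_comm,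
    ← Matrix.mul_assoc, m.g_mul_G, Matrix.one_mul, trace_transpose]
  ring

theorem det_mul_det : m.G.det * m.g.det = 1 := by
  rw [← det_mul, m.G_mul_g, det_one]

/-- A function whose fourth power is `(det g)²` is a density. -/
theorem D_density {w : 𝒜} (h : w ^ 4 = m.g.det ^ 2) (i : ι) : m.D i w = w * (m.Γ i).trace := by
  have := leibniz_root (m.D i) (w := w) (a := 1) (α := 0) (k := 2) m.det_mul_det
    (by rw [one_pow, mul_one]; exact h) (by simp) (m.D_det i)
  rw [sub_zero, Nat.cast_ofNat] at this
  apply eq_of_two_mul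
  linear_combination this

theorem D_G (i : ι) : m.G.map (m.D i) = -(m.Γ i * m.G) - m.G * (m.Γ i)ᵀ := by
  rw [map_inv (m.D i) m.G_mul_g, m.compat]
  simp only [Matrix.mul_add, Matrix.add_mul, Matrix.mul_assoc, m.g_mul_G, Matrix.mul_one]
  rw [← Matrix.mul_assoc m.G m.g, m.G_mul_g, Matrix.one_mul]
  abel

end MetricData

section Projective

variable {ι 𝒜 : Type*} [Fintype ι] [DecidableEq ι] [CommRing 𝒜] [Algebra ℝ 𝒜]

/-- The Benenti tensor of a pair of projectively equivalent metrics. -/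
noncomputable def benenti (m m' : MetricData ι 𝒜) (hD : m'.D = m.D) {φ : ι → 𝒜}
    (hφ : ∀ i, m'.Γ i = m.Γ i + φ i • 1 + vecMulVec (Pi.single i 1) φ) {κ : 𝒜}
    (hκ : κ ^ (2 * (Fintype.card ι + 1)) * m.g.det ^ 2 = m'.g.det ^ 2) : BenentiData ι 𝒜 where
  toMetricData := m
  L := κ • (m'.G * m.g)
  lam := -(κ • m'.G *ᵥ φ)
  SA_L := by
    rw [MetricData.SA, Matrix.mul_smul, transpose_smul, Matrix.smul_mul, transpose_mul, m.g_symm,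
      m'.G_symm, Matrix.mul_assoc]
  covMat_L i := by
    have h1 : m.D i κ = 2 * φ i * κ := by
      have h2 := leibniz_root (m.D i) m'.det_mul_det hκ (m.D_det i) (hD ▸ m'.D_det i)
      have h3 : (m'.Γ i).trace - (m.Γ i).trace = (Fintype.card ι + 1 : ℕ) * φ i := by
        rw [hφ, trace_add, trace_add, trace_smul, trace_one, trace_vecMulVec,
          single_one_dotProduct]
        push_cast
        simp only [smul_eq_mul]
        ring
      rw [h3] at h2
      have h4 : ((Fintype.card ι + 1 : ℕ) : ℝ) ≠ 0 := by positivity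
      have h5 : ((Fintype.card ι + 1 : ℕ) : ℝ) • (m.D i κ - 2 * φ i * κ) = 0 := by
        rw [Algebra.smul_def, map_natCast]
        linear_combination h2
      exact sub_eq_zero.1 ((smul_eq_zero_iff_right h4).1 h5)
    have h6 : m.covMat i (m'.G * m.g) = -(2 * φ i) • (m'.G * m.g)
        - vecMulVec (Pi.single i 1) (m.g *ᵥ m'.G *ᵥ φ)
        - vecMulVec (m'.G *ᵥ φ) (m.g *ᵥ Pi.single i 1) := by
      have h7 : m'.G.map (m.D i) = -(m'.Γ i * m'.G) - m'.G * (m'.Γ i)ᵀ := hD ▸ m'.D_G i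
      have h8 : vecMulVec (Pi.single i 1) φ * (m'.G * m.g)
          = vecMulVec (Pi.single i 1) (m.g *ᵥ m'.G *ᵥ φ) := by
        rw [vecMulVec_mul, ← mulVec_transpose, transpose_mul, m.g_symm, m'.G_symm, mulVec_mulVec]
      have h9 : m'.G * ((vecMulVec (Pi.single i 1) φ)ᵀ * m.g)
          = vecMulVec (m'.G *ᵥ φ) (m.g *ᵥ Pi.single i 1) := by
        rw [transpose_vecMulVec, vecMulVec_mul, mul_vecMulVec, ← mulVec_transpose, m.g_symm]
      rw [MetricData.covMat, map_matrix_mul, h7, m.compat, hφ, ← h8, ← h9]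
      simp only [Matrix.add_mul, Matrix.mul_add, Matrix.sub_mul, Matrix.mul_assoc, transpose_add,
        transpose_smul, transpose_one, Matrix.smul_mul, Matrix.mul_smul, Matrix.one_mul, neg_smul,
        two_mul, add_smul, Matrix.neg_mul]
      abel
    rw [m.covMat_smul, h1, h6, MetricData.rk, MetricData.rk]
    simp only [mulVec_neg, mulVec_smul, vecMulVec_neg, neg_vecMulVec, vecMulVec_smul,
      smul_vecMulVec, smul_sub, smul_neg, neg_smul, smul_smul, mul_comm κ]
    abel

end Projective

section SmoothAlgebra

variable {n : ℕ}

theorem pd_congr {V : Set (Fin n → ℝ)} (hV : IsOpen V) {F F' : (Fin n → ℝ) → ℝ}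
    (h : Set.EqOn F F' V) (i : Fin n) : Set.EqOn (pd i F) (pd i F') V := by
  intro x hx
  rw [pd, pd, (h.eventuallyEq_of_mem (hV.mem_nhds hx)).fderiv_eq]

theorem contDiffOn_pd {V : Set (Fin n → ℝ)} (hV : IsOpen V) {F : (Fin n → ℝ) → ℝ}
    (hF : ContDiffOn ℝ (⊤ : ℕ∞) F V) (i : Fin n) : ContDiffOn ℝ (⊤ : ℕ∞) (pd i F) V :=
  (hF.fderiv_of_isOpen hV (by simp)).clm_apply contDiffOn_const

/-- The algebra of smooth functions on a set. -/
def smoothAlg (V : Set (Fin n → ℝ)) : Subalgebra ℝ (V → ℝ) where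
  carrier := {f | ∃ F : (Fin n → ℝ) → ℝ, ContDiffOn ℝ (⊤ : ℕ∞) F V ∧ ∀ x : V, f x = F x}
  mul_mem' := by
    rintro f g ⟨F, hF, hf⟩ ⟨G, hG, hg⟩
    exact ⟨fun x => F x * G x, hF.mul hG, fun x => by rw [Pi.mul_apply, hf, hg]⟩
  add_mem' := by
    rintro f g ⟨F, hF, hf⟩ ⟨G, hG, hg⟩
    exact ⟨fun x => F x + G x, hF.add hG, fun x => by rw [Pi.add_apply, hf, hg]⟩
  algebraMap_mem' r := ⟨fun _ => r, contDiffOn_const, fun _ => rfl⟩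

variable {V : Set (Fin n → ℝ)}

/-- Restriction of a smooth function. -/
def mkS (F : (Fin n → ℝ) → ℝ) (hF : ContDiffOn ℝ (⊤ : ℕ∞) F V) : smoothAlg V :=
  ⟨fun x => F x, F, hF, fun _ => rfl⟩

theorem mkS_apply (F : (Fin n → ℝ) → ℝ) (hF : ContDiffOn ℝ (⊤ : ℕ∞) F V) (x : V) :
    (mkS F hF).1 x = F x := rfl

/-- A smooth extension of an element of `smoothAlg V`. -/
noncomputable def rep (f : smoothAlg V) : (Fin n → ℝ) → ℝ := f.2.choose

theorem rep_smooth (f : smoothAlg V) : ContDiffOn ℝ (⊤ : ℕ∞) (rep f) V := f.2.choose_spec.1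

theorem rep_apply (f : smoothAlg V) (x : V) : rep f x = f.1 x := (f.2.choose_spec.2 x).symm

/-- Evaluation at a point. -/
def evS (x : V) : smoothAlg V →ₐ[ℝ] ℝ := (Pi.evalAlgHom ℝ (fun _ => ℝ) x).comp (smoothAlg V).val

theorem evS_apply (x : V) (f : smoothAlg V) : evS x f = f.1 x := rfl

theorem evS_ext {f g : smoothAlg V} (h : ∀ x : V, evS x f = evS x g) : f = g :=
  Subtype.ext (funext h)

theorem rep_eqOn {f : smoothAlg V} {F : (Fin n → ℝ) → ℝ} (h : ∀ x : V, evS x f = F x) :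
    Set.EqOn (rep f) F V := fun x hx => (rep_apply f ⟨x, hx⟩).trans (h ⟨x, hx⟩)

theorem differentiableAt_rep (hV : IsOpen V) (f : smoothAlg V) (x : V) :
    DifferentiableAt ℝ (rep f) x :=
  ((rep_smooth f).contDiffAt (hV.mem_nhds x.2)).differentiableAt (by simp)

/-- The partial derivative as a derivation of the algebra of smooth functions. -/
noncomputable def DS (hV : IsOpen V) (i : Fin n) : Derivation ℝ (smoothAlg V) (smoothAlg V) :=
  Derivation.mk'
    { toFun := fun f => mkS (pd i (rep f)) (contDiffOn_pd hV (rep_smooth f) i)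
      map_add' := by
        intro f g
        refine evS_ext fun x => ?_
        have h : Set.EqOn (rep (f + g)) (rep f + rep g) V := rep_eqOn fun y => by
          rw [map_add, Pi.add_apply, rep_apply, rep_apply]; rfl
        rw [map_add]
        simp only [evS_apply, mkS_apply]
        rw [pd_congr hV h i x.2, pd, fderiv_add (differentiableAt_rep hV f x)
          (differentiableAt_rep hV g x)]
        rfl
      map_smul' := by
        intro r f
        refine evS_ext fun x => ?_
        have h : Set.EqOn (rep (r • f)) (r • rep f) V := rep_eqOn fun y => by
          rw [map_smul, Pi.smul_apply, rep_apply]; rfl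
        rw [map_smul]
        simp only [evS_apply, mkS_apply]
        rw [pd_congr hV h i x.2, pd, fderiv_const_smul (differentiableAt_rep hV f x)]
        rfl }
    (by
      intro f g
      refine evS_ext fun x => ?_
      have h : Set.EqOn (rep (f * g)) (rep f * rep g) V := rep_eqOn fun y => by
        rw [map_mul, Pi.mul_apply, rep_apply, rep_apply]; rfl
      rw [map_add, smul_eq_mul, smul_eq_mul, map_mul (evS x), map_mul (evS x)]
      change pd i (rep (f * g)) x = f.1 x * pd i (rep g) x + g.1 x * pd i (rep f) x
      rw [pd_congr hV h i x.2, pd, fderiv_mul (differentiableAt_rep hV f x)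
          (differentiableAt_rep hV g x), rep_apply, rep_apply]
      rfl)

theorem evS_DS (hV : IsOpen V) (i : Fin n) {f : smoothAlg V} {F : (Fin n → ℝ) → ℝ}
    (h : ∀ x : V, evS x f = F x) (x : V) : evS x (DS hV i f) = pd i F x :=
  pd_congr hV (rep_eqOn h) i x.2

theorem DS_comm (hV : IsOpen V) (i j : Fin n) (f : smoothAlg V) :
    DS hV i (DS hV j f) = DS hV j (DS hV i f) := by
  refine evS_ext fun x => ?_
  have h : ∀ k : Fin n, ∀ y : V, evS y (DS hV k f) = pd k (rep f) y := fun k y => rfl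
  rw [evS_DS hV i (h j), evS_DS hV j (h i)]
  have h2 : ContDiffAt ℝ (⊤ : ℕ∞) (rep f) x := (rep_smooth f).contDiffAt (hV.mem_nhds x.2)
  have h3 : DifferentiableAt ℝ (fderiv ℝ (rep f)) x :=
    (((rep_smooth f).fderiv_of_isOpen hV (m := 1) (by norm_cast)).contDiffAt
      (hV.mem_nhds x.2)).differentiableAt (by simp)
  have h4 : ∀ i j : Fin n, pd i (pd j (rep f)) x
      = fderiv ℝ (fderiv ℝ (rep f)) x (Pi.single i 1) (Pi.single j 1) := by
    intro i j
    rw [pd]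
    have e : pd j (rep f) = fun y => fderiv ℝ (rep f) y (Pi.single j 1) := rfl
    rw [e, fderiv_clm_apply h3 (differentiableAt_const _)]
    simp
  rw [h4, h4]
  exact (h2.isSymmSndFDerivAt (by
    rw [minSmoothness_of_isRCLikeNormedField]
    exact WithTop.coe_le_coe.2 (le_top : (2 : ℕ∞) ≤ ⊤))) _ _

theorem DS_coord (hV : IsOpen V) (i j : Fin n) :
    DS hV i (mkS (fun x => x j) (contDiff_apply ℝ ℝ j).contDiffOn) = if i = j then 1 else 0 := by
  refine evS_ext fun x => ?_
  rw [evS_DS hV i (F := fun x => x j) (fun _ => rfl), pd]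
  have : (fun x : Fin n → ℝ => x j) = ContinuousLinearMap.proj (R := ℝ) j := rfl
  rw [this, ContinuousLinearMap.fderiv]
  by_cases h : i = j
  · subst h; simp
  · simp [h, Ne.symm h]

theorem exists_inv {f : smoothAlg V} (h : ∀ x, evS x f ≠ 0) : ∃ f', f' * f = 1 := by
  refine ⟨mkS (fun x => (rep f x)⁻¹) ((rep_smooth f).inv fun x hx => ?_), evS_ext fun x => ?_⟩
  · rw [rep_apply f ⟨x, hx⟩]; exact h ⟨x, hx⟩
  · rw [map_mul, map_one]
    change (rep f x)⁻¹ * evS x f = 1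
    rw [rep_apply]
    exact inv_mul_cancel₀ (h x)

theorem exists_rpow {f : smoothAlg V} (h : ∀ x, evS x f ≠ 0) (p : ℝ) :
    ∃ w : smoothAlg V, ∀ x, evS x w = |evS x f| ^ p := by
  refine ⟨mkS (fun x => |rep f x| ^ p) fun x hx => ?_, fun x => ?_⟩
  · have h0 : rep f x ≠ 0 := by rw [rep_apply f ⟨x, hx⟩]; exact h ⟨x, hx⟩
    exact ((contDiffAt_abs h0).comp_contDiffWithinAt x (rep_smooth f x hx)).rpow_const_of_ne
      (abs_ne_zero.2 h0)
  · change |rep f x| ^ p = _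
    rw [rep_apply, evS_apply]

end SmoothAlgebra

section Setup

variable {n : ℕ} {V : Set (Fin n → ℝ)} {g gbar : (Fin n → ℝ) → Matrix (Fin n) (Fin n) ℝ}

theorem metricOn_mono {U : Set (Fin n → ℝ)} (hg : IsMetricOn U g) (h : V ⊆ U) : IsMetricOn V g :=
  ⟨fun i j => (hg.smooth i j).mono h, fun x hx => hg.symm x (h hx), fun x hx => hg.nondeg x (h hx)⟩

/-- The matrix of smooth functions given by a metric. -/
def matS (hg : IsMetricOn V g) : Matrix (Fin n) (Fin n) (smoothAlg V) :=
  of fun i j => mkS (fun x => g x i j) (hg.smooth i j)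

theorem matS_map (hg : IsMetricOn V g) (x : V) : (matS hg).map (evS x) = g x := rfl

theorem evS_det (M : Matrix (Fin n) (Fin n) (smoothAlg V)) (x : V) :
    evS x M.det = (M.map (evS x)).det :=
  (evS x).map_det M

theorem isUnit_of_evS {f : smoothAlg V} (h : ∀ x, evS x f ≠ 0) : IsUnit f :=
  let ⟨_, hf⟩ := exists_inv h
  IsUnit.of_mul_eq_one_right _ hf

theorem isUnit_det_matS (hg : IsMetricOn V g) : IsUnit (matS hg).det :=
  isUnit_of_evS fun x => by
    rw [evS_det, matS_map]
    exact (hg.nondeg x x.2).ne_zero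

/-- The Levi-Civita data of a metric. -/
noncomputable def metricData (hV : IsOpen V) (hg : IsMetricOn V g) :
    MetricData (Fin n) (smoothAlg V) :=
  leviCivita (DS hV) (DS_comm hV) (g := matS hg) (G := (matS hg)⁻¹)
    (by
      ext i j : 1
      exact evS_ext fun x => congrFun (congrFun (hg.symm x x.2) i) j)
    (mul_nonsing_inv _ (isUnit_det_matS hg))

variable (hV : IsOpen V) (hg : IsMetricOn V g)

theorem metricData_G_map (x : V) : (metricData hV hg).G.map (evS x) = (g x)⁻¹ := by
  symm
  apply inv_eq_left_inv
  have h : (metricData hV hg).G * (metricData hV hg).g = 1 := (metricData hV hg).G_mul_g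
  have h2 := congrArg (fun M => M.map (evS x)) h
  rw [Matrix.map_mul] at h2
  simpa [metricData, leviCivita, matS_map] using h2

theorem evS_Γ (x : V) (i j k : Fin n) :
    evS x ((metricData hV hg).Γ i k j) = Gamma g k i j x := by
  have hG : ∀ l, evS x ((matS hg)⁻¹ k l) = (g x)⁻¹ k l := fun l =>
    congrFun (congrFun (metricData_G_map hV hg x) k) l
  have hD : ∀ i j l, evS x (DS hV i (matS hg j l)) = pd i (fun y => g y j l) x := fun i j l =>
    evS_DS hV i (fun _ => rfl) x
  simp only [metricData, leviCivita, christoffel, of_apply, map_smul, map_sum, map_mul, map_add,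
    map_sub, hG, hD, Gamma, smul_eq_mul]

theorem exists_density : ∃ w w' : smoothAlg V, w' * w = 1 ∧ w ^ 4 = (metricData hV hg).g.det ^ 2 ∧
    (∀ x : V, evS x w = |(g x).det| ^ ((1 : ℝ) / 2)) ∧
    ∀ x : V, evS x w' = |(g x).det| ^ (-(1 : ℝ) / 2) := by
  have h : ∀ x : V, evS x (matS hg).det = (g x).det := fun x => by rw [evS_det, matS_map]
  have h0 : ∀ x : V, (g x).det ≠ 0 := fun x => (hg.nondeg x x.2).ne_zero
  have h1 : ∀ x : V, evS x (matS hg).det ≠ 0 := fun x => by rw [h]; exact h0 x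
  obtain ⟨w, hw⟩ := exists_rpow h1 (1 / 2)
  obtain ⟨w', hw'⟩ := exists_rpow h1 (-1 / 2)
  refine ⟨w, w', evS_ext fun x => ?_, evS_ext fun x => ?_, fun x => by rw [hw, h],
    fun x => by rw [hw', h]⟩
  · rw [map_mul, map_one, hw, hw', ← Real.rpow_add (abs_pos.2 (h1 x))]
    norm_num
  · rw [map_pow, map_pow, hw, ← Real.rpow_natCast, ← Real.rpow_mul (abs_nonneg _)]
    norm_num
    rfl

theorem evS_op {A : Matrix (Fin n) (Fin n) (smoothAlg V)}
    {B : (Fin n → ℝ) → Matrix (Fin n) (Fin n) ℝ} (hA : ∀ x : V, A.map (evS x) = B x)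
    {a : smoothAlg V} {F : (Fin n → ℝ) → ℝ} (ha : ∀ x : V, evS x a = F x) (x : V) :
    evS x ((metricData hV hg).op A a) = assocOp g (fun y => B y * (g y)⁻¹) F x := by
  obtain ⟨w, w', h1, h2, h3, h4⟩ := exists_density hV hg
  have e1 : (metricData hV hg).op A a = w' * ∑ i, ∑ j, DS hV i
      (w * (A * (metricData hV hg).G) i j * DS hV j a) := by
    rw [MetricData.op, MetricData.grad, mulVec_mulVec]
    conv_lhs => rw [← one_mul ((metricData hV hg).dv _), ← h1, mul_assoc,
      (metricData hV hg).density_mul_dv ((metricData hV hg).D_density h2)]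
    congr 1
    refine Finset.sum_congr rfl fun i _ => ?_
    rw [mulVec, dotProduct, Finset.mul_sum, map_sum]
    refine Finset.sum_congr rfl fun j _ => ?_
    rw [mul_assoc]
    rfl
  rw [e1, map_mul, h4, map_sum, assocOp]
  congr 1
  refine Finset.sum_congr rfl fun i _ => ?_
  rw [map_sum]
  refine Finset.sum_congr rfl fun j _ => ?_
  refine evS_DS hV i (fun y => ?_) x
  rw [map_mul, map_mul, h3, evS_DS hV j ha y]
  have : evS y ((A * (metricData hV hg).G) i j) = (B y * (g y)⁻¹) i j := by
    rw [← hA, ← metricData_G_map hV hg, ← Matrix.map_mul]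
    rfl
  rw [this]

/-- Two connections have the same geodesics up to parameterization. -/
def SameGeodesics (V : Set (Fin n → ℝ)) (g gbar : (Fin n → ℝ) → Matrix (Fin n) (Fin n) ℝ) : Prop :=
  ∀ x ∈ V, ∃ ψ : Fin n → ℝ, ∀ i j k, Gamma gbar k i j x
    = Gamma g k i j x + (if k = j then ψ i else 0) + if k = i then ψ j else 0

theorem exists_benenti (hgbar : IsMetricOn V gbar) (h : SameGeodesics V g gbar) :
    ∃ B : BenentiData (Fin n) (smoothAlg V), B.toMetricData = metricData hV hg ∧
      ∀ x : V, B.L.map (evS x) = Lfield g gbar x := by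
  set m := metricData hV hg with hm
  set m' := metricData hV hgbar with hm'
  have hd : ∀ x : V, evS x (m'.g.det * m.G.det) = (gbar x).det / (g x).det := by
    intro x
    rw [map_mul, evS_det, evS_det, hm, metricData_G_map, det_nonsing_inv, Ring.inverse_eq_inv',
      div_eq_mul_inv]
    rfl
  have h0 : ∀ x : V, (g x).det ≠ 0 := fun x => (hg.nondeg x x.2).ne_zero
  have h0' : ∀ x : V, (gbar x).det ≠ 0 := fun x => (hgbar.nondeg x x.2).ne_zero
  obtain ⟨κ, hκ⟩ := exists_rpow (f := m'.g.det * m.G.det)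
    (fun x => by rw [hd]; exact div_ne_zero (h0' x) (h0 x)) ((1 : ℝ) / ((n : ℝ) + 1))
  refine ⟨benenti m m' rfl (φ := fun i => (1 / 2 : ℝ) • (m'.Γ i i i - m.Γ i i i)) ?_ (κ := κ) ?_,
    rfl, fun x => ?_⟩
  · intro i
    ext k j : 1
    refine evS_ext fun x => ?_
    obtain ⟨ψ, hψ⟩ := h x x.2
    simp only [Matrix.add_apply, Matrix.smul_apply, vecMulVec_apply, smul_eq_mul, map_add, map_mul,
      map_smul, map_sub, hm, hm', evS_Γ, hψ, Matrix.one_apply, Pi.single_apply]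
    split_ifs <;> simp <;> ring
  · refine evS_ext fun x => ?_
    have e : |(gbar x).det / (g x).det| = |(gbar x).det| / |(g x).det| := abs_div _ _
    have e1 : evS x m.g.det = (g x).det := by rw [evS_det]; rfl
    have e2 : evS x m'.g.det = (gbar x).det := by rw [evS_det]; rfl
    have e3 : (1 : ℝ) / ((n : ℝ) + 1) * ((2 * (n + 1) : ℕ) : ℝ) = (2 : ℕ) := by
      push_cast
      field_simp
    rw [map_mul, map_pow, map_pow, map_pow, hκ, hd, e1, e2, Fintype.card_fin,
      ← Real.rpow_natCast, ← Real.rpow_mul (abs_nonneg _), e3, Real.rpow_natCast, sq_abs, div_pow,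
      div_mul_cancel₀ _ (pow_ne_zero 2 (h0 x))]
  · change (κ • (m'.G * m.g)).map (evS x) = _
    ext i j
    have e1 : evS x ((m'.G * m.g) i j) = ((gbar x)⁻¹ * g x) i j := by
      rw [← metricData_G_map hV hgbar, ← matS_map hg x, ← Matrix.map_mul]
      rfl
    rw [map_apply, Matrix.smul_apply, smul_eq_mul, map_mul, e1, hκ, hd]
    rfl

end Setup

section Interpolation

theorem adjugate_pencil_eq_sum {n : ℕ} {s : Finset ℝ} (hs : s.card = n + 1)
    (L : Matrix (Fin n) (Fin n) ℝ) (t : ℝ) :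
    (t • 1 - L).adjugate = ∑ v ∈ s, (Lagrange.basis s id v).eval t • (v • 1 - L).adjugate := by
  have key : ∀ a b, ∃ p : Polynomial ℝ, p.natDegree ≤ n ∧
      ∀ u : ℝ, p.eval u = (u • 1 - L).adjugate a b := by
    intro a b
    refine ⟨_, (Polynomial.natDegree_det_X_add_C_le ((1 : Matrix (Fin n) (Fin n) ℝ).updateRow b 0)
      ((-L).updateRow b (Pi.single a 1))).trans (Fintype.card_fin n).le, fun u => ?_⟩
    rw [adjugate_apply, ← Polynomial.coe_evalRingHom, RingHom.map_det]
    congr 1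
    ext i j
    by_cases h : i = b
    · subst h; simp
    · simp [h, Matrix.one_apply, sub_eq_add_neg]
      split_ifs <;> simp
  ext a b
  obtain ⟨p, hp, h⟩ := key a b
  have h1 : p.degree < s.card := by
    rw [hs]
    exact (Polynomial.natDegree_le_iff_degree_le.1 hp).trans_lt (by exact_mod_cast Nat.lt_succ_self n)
  have h2 := Lagrange.eq_interpolate (v := id) (Function.injective_id.injOn) h1
  rw [← h t, h2, Lagrange.interpolate_apply, Polynomial.eval_finsetSum, Matrix.sum_apply]
  refine Finset.sum_congr rfl fun v _ => ?_
  rw [Polynomial.eval_mul, Polynomial.eval_C, Matrix.smul_apply, id, h v, smul_eq_mul, mul_comm]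

namespace MetricData

variable {ι 𝒜 : Type*} [Fintype ι] [DecidableEq ι] [CommRing 𝒜] [Algebra ℝ 𝒜]
variable (m : MetricData ι 𝒜)

theorem dv_sum_smul {κ : Type*} (s : Finset κ) (c : κ → ℝ) (X : κ → ι → 𝒜) :
    m.dv (∑ v ∈ s, c v • X v) = ∑ v ∈ s, c v • m.dv (X v) := by
  have h : ∀ (r : ℝ) (Y : ι → 𝒜), m.dv (r • Y) = r • m.dv Y := by
    intro r Y
    simp only [dv_eq, covVec, mulVec_smul, Pi.add_apply, Pi.smul_apply, Derivation.map_smul, smul_add,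
      Finset.smul_sum]
  induction s using Finset.cons_induction with
  | empty => simpa using h 0 0
  | cons v s hv ih => rw [Finset.sum_cons, Finset.sum_cons, dv_add, ih, h]

theorem op_sum {κ : Type*} (s : Finset κ) (c : κ → ℝ) (A : κ → Matrix ι ι 𝒜) (f : 𝒜) :
    m.op (∑ v ∈ s, c v • A v) f = ∑ v ∈ s, c v • m.op (A v) f := by
  simp only [op, sum_mulVec, smul_mulVec, dv_sum_smul]

theorem op_map_sum {κ : Type*} (s : Finset κ) (c : κ → ℝ) (A : Matrix ι ι 𝒜) (f : κ → 𝒜) :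
    m.op A (∑ v ∈ s, c v • f v) = ∑ v ∈ s, c v • m.op A (f v) := by
  have : m.df (∑ v ∈ s, c v • f v) = ∑ v ∈ s, c v • m.df (f v) := by
    ext i
    simp only [df, map_sum, Derivation.map_smul, Finset.sum_apply, Pi.smul_apply]
  simp only [op, grad, this, mulVec_sum, mulVec_smul, dv_sum_smul]

end MetricData

end Interpolation

section Local

variable {n : ℕ} {V : Set (Fin n → ℝ)} {g gbar : (Fin n → ℝ) → Matrix (Fin n) (Fin n) ℝ}

theorem evS_pencil {B : BenentiData (Fin n) (smoothAlg V)}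
    (hL : ∀ x : V, B.L.map (evS x) = Lfield g gbar x) (t : ℝ) (x : V) :
    (B.pencil t).map (evS x) = t • 1 - Lfield g gbar x := by
  rw [← hL]
  ext i j
  simp only [BenentiData.pencil, map_apply, Matrix.sub_apply, Matrix.smul_apply, map_sub, map_smul,
    Matrix.one_apply]
  split_ifs <;> simp

theorem evS_adjugate_pencil {B : BenentiData (Fin n) (smoothAlg V)}
    (hL : ∀ x : V, B.L.map (evS x) = Lfield g gbar x) (t : ℝ) (x : V) :
    (B.pencil t).adjugate.map (evS x) = Sfield g gbar t x := by
  rw [Sfield, ← evS_pencil hL]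
  exact (evS x).map_adjugate (B.pencil t)

theorem adjugate_pencil_eq_sum_smoothAlg {B : BenentiData (Fin n) (smoothAlg V)}
    (hL : ∀ x : V, B.L.map (evS x) = Lfield g gbar x) {s : Finset ℝ} (hs : s.card = n + 1) (t : ℝ) :
    (B.pencil t).adjugate
      = ∑ v ∈ s, (Lagrange.basis s id v).eval t • (B.pencil v).adjugate := by
  ext i j : 1
  refine evS_ext fun x => ?_
  have h : ∀ u i j, evS x ((B.pencil u).adjugate i j) = Sfield g gbar u x i j := fun u i j =>
    congrFun (congrFun (evS_adjugate_pencil hL u x) i) j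
  rw [h, Matrix.sum_apply, map_sum, Sfield, adjugate_pencil_eq_sum hs, Matrix.sum_apply]
  refine Finset.sum_congr rfl fun v _ => ?_
  rw [Matrix.smul_apply, Matrix.smul_apply, map_smul, h, Sfield]

theorem op_comm_of_nodes (hV : IsOpen V) (hg : IsMetricOn V g)
    {B : BenentiData (Fin n) (smoothAlg V)} (hB : B.toMetricData = metricData hV hg)
    (hL : ∀ x : V, B.L.map (evS x) = Lfield g gbar x) {s : Finset ℝ} (hs : s.card = n + 1)
    (hdet : ∀ v ∈ s, ∀ x : V, (v • 1 - Lfield g gbar x).det ≠ 0) (t u : ℝ) (f : smoothAlg V) :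
    B.op (B.pencil t).adjugate (B.op (B.pencil u).adjugate f)
      = B.op (B.pencil u).adjugate (B.op (B.pencil t).adjugate f) := by
  obtain ⟨w, w', h1, h2, -, -⟩ := exists_density hV hg
  rw [← hB] at h2
  have hx : ∀ i j, B.D i (mkS (fun x => x j) (contDiff_apply ℝ ℝ j).contDiffOn)
      = if i = j then 1 else 0 := by
    rw [show B.D = (metricData hV hg).D by rw [← hB]]
    exact DS_coord hV
  have hu : ∀ v ∈ s, IsUnit (B.pencil v).det := fun v hv => isUnit_of_evS fun x => by
    rw [evS_det, evS_pencil hL]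
    exact hdet v hv x
  have hadj : ∀ v ∈ s, (B.pencil v).adjugate = (B.pencil v).det • (B.pencil v)⁻¹ := by
    intro v hv
    rw [inv_def, smul_smul, Ring.mul_inverse_cancel _ (hu v hv), one_smul]
  have hc : ∀ v ∈ s, ∀ v' ∈ s, B.op (B.pencil v).adjugate (B.op (B.pencil v').adjugate f)
      = B.op (B.pencil v').adjugate (B.op (B.pencil v).adjugate f) := fun v hv v' hv' =>
    B.op_comm h1 (B.D_density h2) hx (nonsing_inv_mul _ (hu v hv)) (nonsing_inv_mul _ (hu v' hv'))
      (hadj v hv) (hadj v' hv') f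
  rw [adjugate_pencil_eq_sum_smoothAlg hL hs t, adjugate_pencil_eq_sum_smoothAlg hL hs u]
  simp only [B.op_sum, B.op_map_sum, Finset.smul_sum]
  rw [Finset.sum_comm]
  refine Finset.sum_congr rfl fun v hv => Finset.sum_congr rfl fun v' hv' => ?_
  rw [hc v' hv' v hv, smul_comm]

theorem exists_nodes (L : Matrix (Fin n) (Fin n) ℝ) :
    ∃ s : Finset ℝ, s.card = n + 1 ∧ ∀ v ∈ s, (v • 1 - L).det ≠ 0 := by
  obtain ⟨s, hs, hc⟩ := L.charpoly.roots.toFinset.finite_toSet.infinite_compl.exists_subset_card_eq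
    (n + 1)
  refine ⟨s, hc, fun v hv h => hs hv ?_⟩
  rw [Finset.mem_coe, Multiset.mem_toFinset, Polynomial.mem_roots L.charpoly_monic.ne_zero,
    Polynomial.IsRoot, eval_charpoly, ← h, scalar_apply, smul_one_eq_diagonal]

theorem Khat_comm_of_sameGeodesics {U : Set (Fin n → ℝ)} (hU : IsOpen U) (hg : IsMetricOn U g)
    (hgbar : IsMetricOn U gbar) (h : SameGeodesics U g gbar) (t u : ℝ) {f : (Fin n → ℝ) → ℝ}
    (hf : ContDiffOn ℝ (⊤ : ℕ∞) f U) {x₀ : Fin n → ℝ} (hx₀ : x₀ ∈ U) :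
    Khat g gbar t (Khat g gbar u f) x₀ = Khat g gbar u (Khat g gbar t f) x₀ := by
  obtain ⟨s, hs, hs0⟩ := exists_nodes (Lfield g gbar x₀)
  obtain ⟨B, -, hL⟩ := exists_benenti hU hg hgbar h
  let V : Set (Fin n → ℝ) := ⋂ v ∈ s, U ∩ rep (B.pencil v).det ⁻¹' {0}ᶜ
  have hp : ∀ v, ∀ x (hx : x ∈ U), rep (B.pencil v).det x = (v • 1 - Lfield g gbar x).det := by
    intro v x hx
    rw [rep_apply _ ⟨x, hx⟩, ← evS_apply, evS_det, evS_pencil hL]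
  have hVo : IsOpen V := isOpen_biInter_finset fun v _ =>
    (rep_smooth _).continuousOn.isOpen_inter_preimage hU isOpen_compl_singleton
  have hVx : x₀ ∈ V := Set.mem_iInter₂.2 fun v hv => ⟨hx₀, by
    rw [Set.mem_preimage, hp v x₀ hx₀]; exact hs0 v hv⟩
  obtain ⟨v₀, hv₀⟩ : s.Nonempty := Finset.card_pos.1 (by omega)
  have hVU : V ⊆ U := fun x hx => (Set.mem_iInter₂.1 hx v₀ hv₀).1
  have hdet : ∀ v ∈ s, ∀ x : V, (v • 1 - Lfield g gbar x).det ≠ 0 := fun v hv x => by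
    rw [← hp v x (hVU x.2)]
    exact (Set.mem_iInter₂.1 x.2 v hv).2
  have hgV := metricOn_mono hg hVU
  obtain ⟨B', hB, hL'⟩ := exists_benenti hVo hgV (metricOn_mono hgbar hVU)
    fun x hx => h x (hVU hx)
  have hK : ∀ (r : ℝ) {a : smoothAlg V} {F : (Fin n → ℝ) → ℝ}, (∀ x : V, evS x a = F x) →
      ∀ x : V, evS x (B'.op (B'.pencil r).adjugate a) = Khat g gbar r F x := by
    intro r a F ha x
    rw [hB]
    exact evS_op hVo hgV (evS_adjugate_pencil hL' r) ha x
  have h0 : ∀ x : V, evS x (mkS f (hf.mono hVU)) = f x := fun _ => rfl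
  rw [← hK t (hK u h0) ⟨x₀, hVx⟩, ← hK u (hK t h0) ⟨x₀, hVx⟩,
    op_comm_of_nodes hVo hgV hB hL' hs hdet]

end Local

section Quadratic

theorem eq_of_quadratic_parallel {n : ℕ} {T : Fin n → Fin n → Fin n → ℝ}
    (hT : ∀ k i j, T k i j = T k j i)
    (h : ∀ v : Fin n → ℝ, v ≠ 0 → ∃ c, ∀ k, ∑ i, ∑ j, T k i j * v i * v j = c * v k) :
    ∀ k i j, T k i j = (if k = j then T i i i / 2 else 0) + if k = i then T j j j / 2 else 0 := by
  have h1 : ∀ i k, k ≠ i → T k i i = 0 := by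
    intro i k hk
    obtain ⟨c, hc⟩ := h (Pi.single i 1) (by simp)
    simpa [Pi.single_apply, hk] using hc k
  have h2 : ∀ i j, i ≠ j → ∀ a : ℝ, ∃ c, ∀ k, T k i i + 2 * a * T k i j + a ^ 2 * T k j j
      = c * ((if k = i then 1 else 0) + a * if k = j then 1 else 0) := by
    intro i j hij a
    obtain ⟨c, hc⟩ := h (Pi.single i 1 + a • Pi.single j 1) (fun h0 => by
      have := congrFun h0 i
      simp [hij] at this)
    refine ⟨c, fun k => ?_⟩
    have := hc k
    simp [Pi.single_apply, mul_add, add_mul, Finset.sum_add_distrib] at this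
    rw [mul_add, ← hT k i j] at *
    simp only [mul_ite, mul_one, mul_zero]
    rw [← this]
    ring
  intro k i j
  by_cases hij : i = j
  · subst hij
    by_cases hk : k = i
    · subst hk; simp
    · simp [hk, h1 i k hk]
  · obtain ⟨c, hc⟩ := h2 i j hij 1
    obtain ⟨d, hd⟩ := h2 i j hij (-1)
    have a1 := hc i
    have a2 := hc j
    have b1 := hd i
    have b2 := hd j
    have e1 := h1 i j (Ne.symm hij)
    have e2 := h1 j i hij
    simp only [hij, Ne.symm hij, if_true, if_false] at a1 a2 b1 b2
    by_cases hk : k = i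
    · subst hk
      simp only [hij, if_true, if_false]
      linarith
    · by_cases hk' : k = j
      · subst hk'
        simp only [hk, if_true, if_false]
        linarith
      · have := hc k
        simp only [hk, hk', if_false, h1 i k hk, h1 j k hk'] at this ⊢
        linarith

end Quadratic

section ODE

theorem exists_smooth_integralCurve {E : Type*} [NormedAddCommGroup E] [NormedSpace ℝ E]
    [CompleteSpace E] {F : E → E} {W : Set E} (hW : IsOpen W) (hF : ContDiffOn ℝ (⊤ : ℕ∞) F W)
    {z : E} (hz : z ∈ W) : ∃ α : ℝ → E, α 0 = z ∧ ∃ ε > (0 : ℝ),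
      ContDiffOn ℝ (⊤ : ℕ∞) α (Set.Ioo (-ε) ε) ∧
      ∀ t ∈ Set.Ioo (-ε) ε, α t ∈ W ∧ HasDerivAt α (F (α t)) t := by
  obtain ⟨α, h0, ε, hε, h⟩ := ((hF.contDiffAt (hW.mem_nhds hz)).of_le
    (m := 1) (by exact_mod_cast le_top))
    |>.exists_forall_mem_closedBall_exists_eq_forall_mem_Ioo_hasDerivAt₀ 0
  rw [zero_sub, zero_add] at h
  have hc : ContinuousAt α 0 := (h 0 ⟨by linarith, hε⟩).continuousAt
  obtain ⟨δ, hδ, hδ'⟩ := Metric.mem_nhds_iff.1 (hc.preimage_mem_nhds (hW.mem_nhds (h0 ▸ hz)))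
  have hm : ∀ t ∈ Set.Icc (-(min ε δ / 2)) (min ε δ / 2), α t ∈ W ∧ HasDerivAt α (F (α t)) t := by
    intro t ht
    have hp : 0 < min ε δ := lt_min hε hδ
    have h1 := min_le_left ε δ
    have h2 := min_le_right ε δ
    refine ⟨hδ' ?_, h t ⟨by linarith [ht.1], by linarith [ht.2]⟩⟩
    rw [Metric.mem_ball, dist_zero_right, Real.norm_eq_abs, abs_lt]
    exact ⟨by linarith [ht.1], by linarith [ht.2]⟩
  refine ⟨α, h0, min ε δ / 2, half_pos (lt_min hε hδ), ?_,
    fun t ht => hm t (Set.Ioo_subset_Icc_self ht)⟩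
  refine ContDiffOn.mono ?_ Set.Ioo_subset_Icc_self
  refine ODE.contDiffOn_enat_Icc_of_hasDerivWithinAt (f := fun _ => F) (u := W) ?_
    (fun t ht => (hm t ht).2.hasDerivWithinAt) fun t ht => (hm t ht).1
  exact hF.comp contDiffOn_snd fun p hp => hp.2

variable {n : ℕ} {U : Set (Fin n → ℝ)} {g gbar : (Fin n → ℝ) → Matrix (Fin n) (Fin n) ℝ}

theorem contDiffOn_Gamma (hU : IsOpen U) (hg : IsMetricOn U g) (k i j : Fin n) :
    ContDiffOn ℝ (⊤ : ℕ∞) (Gamma g k i j) U :=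
  (rep_smooth ((metricData hU hg).Γ i k j)).congr
    (rep_eqOn fun x => evS_Γ hU hg x i j k).symm

theorem exists_geodesic (hU : IsOpen U) (hg : IsMetricOn U g) {x : Fin n → ℝ} (hx : x ∈ U)
    {v : Fin n → ℝ} (hv : v ≠ 0) : ∃ (γ : ℝ → Fin n → ℝ) (ε : ℝ), 0 < ε ∧
      IsGeodesicOn U g γ (Set.Ioo (-ε) ε) ∧ γ 0 = x ∧ (∀ k, deriv (fun s => γ s k) 0 = v k) ∧
      ∀ t ∈ Set.Ioo (-ε) ε, ∃ k, deriv (fun s => γ s k) t ≠ 0 := by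
  let F : (Fin n → ℝ) × (Fin n → ℝ) → (Fin n → ℝ) × (Fin n → ℝ) := fun z =>
    (z.2, fun k => -∑ i, ∑ j, Gamma g k i j z.1 * z.2 i * z.2 j)
  have hF : ContDiffOn ℝ (⊤ : ℕ∞) F (U ×ˢ {0}ᶜ) := by
    refine contDiffOn_snd.prodMk (contDiffOn_pi.2 fun k => ContDiffOn.neg ?_)
    have hc : ∀ i : Fin n, ContDiffOn ℝ (⊤ : ℕ∞) (fun z : (Fin n → ℝ) × (Fin n → ℝ) => z.2 i)
        (U ×ˢ {0}ᶜ) := fun i => ((contDiff_apply ℝ ℝ i).comp contDiff_snd).contDiffOn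
    exact ContDiffOn.sum fun i _ => ContDiffOn.sum fun j _ =>
      (((contDiffOn_Gamma hU hg k i j).comp contDiffOn_fst fun z hz => hz.1).mul (hc i)).mul (hc j)
  obtain ⟨α, h0, ε, hε, hα, h⟩ := exists_smooth_integralCurve
    (hU.prod isOpen_compl_singleton) hF (z := (x, v)) ⟨hx, hv⟩
  have hd : ∀ t ∈ Set.Ioo (-ε) ε, ∀ k, HasDerivAt (fun s => (α s).1 k) ((α t).2 k) t :=
    fun t ht k => hasDerivAt_pi.1 (h t ht).2.fst k
  have hd2 : ∀ t ∈ Set.Ioo (-ε) ε, ∀ k, HasDerivAt (fun s => (α s).2 k)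
      (-∑ i, ∑ j, Gamma g k i j (α t).1 * (α t).2 i * (α t).2 j) t :=
    fun t ht k => hasDerivAt_pi.1 (h t ht).2.snd k
  refine ⟨fun t => (α t).1, ε, hε, ⟨⟨isOpen_Ioo, Set.ordConnected_Ioo⟩, fun k => ?_,
    fun t ht => (h t ht).1.1, fun t ht k => ?_⟩, congrArg Prod.fst h0, fun k => ?_, fun t ht => ?_⟩
  · exact contDiffOn_pi.1 (contDiff_fst.comp_contDiffOn hα) k
  · have e : deriv (fun s => (α s).1 k) =ᶠ[nhds t] fun s => (α s).2 k :=
      Filter.eventuallyEq_of_mem (isOpen_Ioo.mem_nhds ht) fun s hs => (hd s hs k).deriv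
    rw [e.deriv_eq, (hd2 t ht k).deriv]
    simp only [(hd t ht _).deriv]
    ring
  · rw [(hd 0 ⟨by linarith, hε⟩ k).deriv, h0]
  · obtain ⟨k, hk⟩ := Function.ne_iff.1 (h t ht).1.2
    exact ⟨k, by rw [(hd t ht k).deriv]; exact hk⟩

theorem exists_parallel (hU : IsOpen U) (hg : IsMetricOn U g) (hproj : ProjEquiv U g gbar)
    {x : Fin n → ℝ} (hx : x ∈ U) {v : Fin n → ℝ} (hv : v ≠ 0) :
    ∃ c, ∀ k, ∑ i, ∑ j, (Gamma gbar k i j x - Gamma g k i j x) * v i * v j = c * v k := by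
  obtain ⟨γ, ε, hε, hγ, h0, h1, h2⟩ := exists_geodesic hU hg hx hv
  obtain ⟨φ, J, hJ, hφ, -, himg, hφ', hβ⟩ := hproj γ _ hγ h2
  obtain ⟨s₀, hs₀, hs⟩ : (0 : ℝ) ∈ φ '' J := himg ▸ ⟨by linarith, hε⟩
  have hφd : ∀ s ∈ J, DifferentiableAt ℝ φ s := fun s hs =>
    (hφ.contDiffAt (hJ.1.mem_nhds hs)).differentiableAt (by simp)
  have hφd2 : DifferentiableAt ℝ (deriv φ) s₀ :=
    ((hφ.deriv_of_isOpen (m := 1) hJ.1 (by norm_cast)).contDiffAt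
      (hJ.1.mem_nhds hs₀)).differentiableAt (by simp)
  have hmem : ∀ s ∈ J, φ s ∈ Set.Ioo (-ε) ε := fun s hs => himg ▸ Set.mem_image_of_mem φ hs
  have hγd : ∀ t ∈ Set.Ioo (-ε) ε, ∀ k, DifferentiableAt ℝ (fun s => γ s k) t := fun t ht k =>
    ((hγ.smooth k).contDiffAt (isOpen_Ioo.mem_nhds ht)).differentiableAt (by simp)
  have hγd2 : ∀ k, DifferentiableAt ℝ (deriv fun s => γ s k) (φ s₀) := fun k =>
    (((hγ.smooth k).deriv_of_isOpen (m := 1) isOpen_Ioo (by norm_cast)).contDiffAt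
      (isOpen_Ioo.mem_nhds (hmem s₀ hs₀))).differentiableAt (by simp)
  have hβ1 : ∀ s ∈ J, ∀ k, deriv (fun s => (γ ∘ φ) s k) s
      = deriv (fun s => γ s k) (φ s) * deriv φ s := fun s hs k =>
    ((hγd _ (hmem s hs) k).hasDerivAt.comp s (hφd s hs).hasDerivAt).deriv
  have hβ2 : ∀ k, deriv (deriv fun s => (γ ∘ φ) s k) s₀
      = deriv (deriv fun s => γ s k) (φ s₀) * deriv φ s₀ * deriv φ s₀
        + deriv (fun s => γ s k) (φ s₀) * deriv (deriv φ) s₀ := by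
    intro k
    have e : (deriv fun s => (γ ∘ φ) s k) =ᶠ[nhds s₀]
        fun s => deriv (fun s => γ s k) (φ s) * deriv φ s :=
      Filter.eventuallyEq_of_mem (hJ.1.mem_nhds hs₀) fun s hs => hβ1 s hs k
    rw [e.deriv_eq]
    exact (((hγd2 k).hasDerivAt.comp s₀ (hφd s₀ hs₀).hasDerivAt).mul hφd2.hasDerivAt).deriv
  refine ⟨-deriv (deriv φ) s₀ / deriv φ s₀ ^ 2, fun k => ?_⟩
  have E1 := hβ.eqn s₀ hs₀ k
  have E2 := hγ.eqn 0 ⟨by linarith, hε⟩ k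
  simp only [hβ2, hβ1 s₀ hs₀] at E1
  simp only [hs, h1, Function.comp_apply, h0] at E1 E2
  have e3 : ∀ i j, Gamma gbar k i j x * (v i * deriv φ s₀) * (v j * deriv φ s₀)
      = deriv φ s₀ ^ 2 * (Gamma gbar k i j x * v i * v j) := fun i j => by ring
  simp only [e3, ← Finset.mul_sum] at E1
  simp only [sub_mul, Finset.sum_sub_distrib]
  have h3 := hφ' s₀ hs₀
  field_simp
  linear_combination E1 - deriv φ s₀ ^ 2 * E2

theorem Gamma_symm (hU : IsOpen U) (hg : IsMetricOn U g) {x : Fin n → ℝ} (hx : x ∈ U)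
    (k i j : Fin n) : Gamma g k i j x = Gamma g k j i x := by
  rw [← evS_Γ hU hg ⟨x, hx⟩, ← evS_Γ hU hg ⟨x, hx⟩, (metricData hU hg).torsion]

theorem sameGeodesics_of_projEquiv (hU : IsOpen U) (hg : IsMetricOn U g)
    (hgbar : IsMetricOn U gbar) (hproj : ProjEquiv U g gbar) : SameGeodesics U g gbar := by
  intro x hx
  have h := eq_of_quadratic_parallel (T := fun k i j => Gamma gbar k i j x - Gamma g k i j x)
    (fun k i j => by rw [Gamma_symm hU hg hx, Gamma_symm hU hgbar hx])
    fun v hv => exists_parallel hU hg hproj hx hv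
  refine ⟨fun i => (Gamma gbar i i i x - Gamma g i i i x) / 2, fun i j k => ?_⟩
  rw [add_assoc, ← h k i j]
  ring

end ODE

end ProjComm

theorem commutation_of_Khat_operators {n : ℕ} (hn : 2 ≤ n) (U : Set (Fin n → ℝ)) (hUo : IsOpen U) (hUc : IsConnected U)
    (g gbar : (Fin n → ℝ) → Matrix (Fin n) (Fin n) ℝ)
    (hg : IsMetricOn U g) (hgbar : IsMetricOn U gbar)
    (hproj : ProjEquiv U g gbar) (t s : ℝ)
    (f : (Fin n → ℝ) → ℝ) (hf : ContDiffOn ℝ (⊤ : ℕ∞) f U) :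
    ∀ x ∈ U, Khat g gbar t (Khat g gbar s f) x = Khat g gbar s (Khat g gbar t f) x := by
  exact fun x hx => ProjComm.Khat_comm_of_sameGeodesics hUo hg hgbar
    (ProjComm.sameGeodesics_of_projEquiv hUo hg hgbar hproj) t s hf hx
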